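/- arXiv:1609.05828 — 3 statements merged into one kernel-verified Lean document; each statement's English description precedes it below -/
import Mathlib

section
/- Let W be the space of real-valued functions on ℤ×ℤ supported on the interior vertices of S, and let X be the space of real-valued functions c on the interior edges of S such that for every square of S, with values on its boundary edges taken to be 0, the sum of the values at its bottom and top edges equals the sum of the values at its left and right edges. Then the linear map A : W → X defined by (Aw)({v₁,v₂}) = (w(v₁)+w(v₂))/2 for each interior edge with endpoints v₁, v₂ is well defined and is a bijection from W onto X. (This is the statement that the interpolation π_h is a bijection from the conforming bilinear space Q_{1,h,0} onto the P1-nonconforming space NC_h,0, expressed in the coordinates of vertex values and edge-midpoint values.) -/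
/-- The closed unit square `[i,i+1] × [j,j+1] ⊆ ℝ²` indexed by `q = (i,j) ∈ ℤ × ℤ`. -/
def unitSq (q : ℤ × ℤ) : Set (ℝ × ℝ) :=
  Set.Icc (q.1 : ℝ) (q.1 + 1) ×ˢ Set.Icc (q.2 : ℝ) (q.2 + 1)

/-- `Ω̄`, the union of the closed squares of the mesh `S`. -/
def meshRegion (S : Finset (ℤ × ℤ)) : Set (ℝ × ℝ) := ⋃ q ∈ S, unitSq q

/-- `v` is an interior vertex of `S`: all four grid squares having `v` as a corner belong
to `S`. -/
abbrev interiorVertex (S : Finset (ℤ × ℤ)) (v : ℤ × ℤ) : Prop :=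
  (v.1 - 1, v.2 - 1) ∈ S ∧ (v.1 - 1, v.2) ∈ S ∧ (v.1, v.2 - 1) ∈ S ∧ v ∈ S

/-- `v` is a mesh vertex of `S`: it is a corner of some square of `S`. -/
abbrev meshVertex (S : Finset (ℤ × ℤ)) (v : ℤ × ℤ) : Prop :=
  (v.1 - 1, v.2 - 1) ∈ S ∨ (v.1 - 1, v.2) ∈ S ∨ (v.1, v.2 - 1) ∈ S ∨ v ∈ S

/-- `v` is a boundary vertex of `S`: a mesh vertex which is not interior. -/
abbrev boundaryVertex (S : Finset (ℤ × ℤ)) (v : ℤ × ℤ) : Prop :=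
  meshVertex S v ∧ ¬ interiorVertex S v

/-- The four corners of the square indexed by `q`. -/
def cornersF (q : ℤ × ℤ) : Finset (ℤ × ℤ) :=
  {q, (q.1 + 1, q.2), (q.1, q.2 + 1), (q.1 + 1, q.2 + 1)}

/-- `q` is an interior square: all four of its corners are interior vertices. -/
abbrev interiorSquare (S : Finset (ℤ × ℤ)) (q : ℤ × ℤ) : Prop :=
  interiorVertex S q ∧ interiorVertex S (q.1 + 1, q.2) ∧
    interiorVertex S (q.1, q.2 + 1) ∧ interiorVertex S (q.1 + 1, q.2 + 1)

/-- The square `(i,j)` is red if `i + j` is even (and black otherwise). -/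
abbrev isRed (q : ℤ × ℤ) : Prop := (q.1 + q.2) % 2 = 0

/-- The standing assumptions on the mesh `S`: it is nonempty, `Ω` is connected and simply
connected, no square has four boundary corners, every grid edge shared by two squares of `S`
has an interior endpoint, and no square has exactly two boundary corners lying at diagonally
opposite corners. -/
structure Standing (S : Finset (ℤ × ℤ)) : Prop where
  nonempty : S.Nonempty
  connected : IsConnected (interior (meshRegion S))
  simplyConnected : SimplyConnectedSpace ↥(interior (meshRegion S))
  noFourBoundary : ∀ q ∈ S,
    ¬ (boundaryVertex S q ∧ boundaryVertex S (q.1 + 1, q.2) ∧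
        boundaryVertex S (q.1, q.2 + 1) ∧ boundaryVertex S (q.1 + 1, q.2 + 1))
  edgeH : ∀ v : ℤ × ℤ, v ∈ S → (v.1, v.2 - 1) ∈ S →
    interiorVertex S v ∨ interiorVertex S (v.1 + 1, v.2)
  edgeV : ∀ v : ℤ × ℤ, v ∈ S → (v.1 - 1, v.2) ∈ S →
    interiorVertex S v ∨ interiorVertex S (v.1, v.2 + 1)
  noDiagOne : ∀ q ∈ S,
    ¬ (boundaryVertex S q ∧ boundaryVertex S (q.1 + 1, q.2 + 1) ∧
        interiorVertex S (q.1 + 1, q.2) ∧ interiorVertex S (q.1, q.2 + 1))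
  noDiagTwo : ∀ q ∈ S,
    ¬ (boundaryVertex S (q.1 + 1, q.2) ∧ boundaryVertex S (q.1, q.2 + 1) ∧
        interiorVertex S q ∧ interiorVertex S (q.1 + 1, q.2 + 1))

/-- The discrete `x`-derivative `∂ˣc(Q)` of a scalar vertex function on the square `Q`. -/
def dX (c : ℤ × ℤ → ℝ) (q : ℤ × ℤ) : ℝ :=
  c (q.1 + 1, q.2) + c (q.1 + 1, q.2 + 1) - c (q.1, q.2) - c (q.1, q.2 + 1)

/-- The discrete `y`-derivative `∂ʸc(Q)` of a scalar vertex function on the square `Q`. -/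
def dY (c : ℤ × ℤ → ℝ) (q : ℤ × ℤ) : ℝ :=
  c (q.1, q.2 + 1) + c (q.1 + 1, q.2 + 1) - c (q.1, q.2) - c (q.1 + 1, q.2)

/-- The discrete divergence `(Dc)(Q) = ∂ˣc¹(Q) + ∂ʸc²(Q)`. -/
def Ddiv (c : ℤ × ℤ → ℝ × ℝ) (q : ℤ × ℤ) : ℝ :=
  dX (fun v => (c v).1) q + dY (fun v => (c v).2) q

/-- The discrete curl `(Cc)(Q) = ∂ˣc²(Q) − ∂ʸc¹(Q)`. -/
def Ccurl (c : ℤ × ℤ → ℝ × ℝ) (q : ℤ × ℤ) : ℝ :=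
  dX (fun v => (c v).2) q - dY (fun v => (c v).1) q

/-- The horizontal grid edge from `v` to `v + (1,0)` is an interior edge of `S` (it is shared
by the two squares `(v.1, v.2)` and `(v.1, v.2 − 1)` of `S`). -/
abbrev hIntEdge (S : Finset (ℤ × ℤ)) (v : ℤ × ℤ) : Prop :=
  v ∈ S ∧ (v.1, v.2 - 1) ∈ S

/-- The vertical grid edge from `v` to `v + (0,1)` is an interior edge of `S` (it is shared
by the two squares `(v.1, v.2)` and `(v.1 − 1, v.2)` of `S`). -/
abbrev vIntEdge (S : Finset (ℤ × ℤ)) (v : ℤ × ℤ) : Prop :=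
  v ∈ S ∧ (v.1 - 1, v.2) ∈ S

/-- Continuous maps to the circle `ℝ / ℤ` lift to `ℝ` over simply connected open sets. -/
theorem exists_continuousOn_lift {E : Type*} [TopologicalSpace E] [LocallyPathConnectedSpace E]
    {U : Set E} (hU : IsOpen U) (hsc : SimplyConnectedSpace U) {F : E → AddCircle (1 : ℝ)}
    (hF : ContinuousOn F U) :
    ∃ θ : E → ℝ, ContinuousOn θ U ∧ ∀ z ∈ U, (θ z : AddCircle (1 : ℝ)) = F z := by
  classical
  have := hU.locallyPathConnectedSpace
  obtain ⟨z₀⟩ : Nonempty U := inferInstance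
  obtain ⟨e₀, he₀⟩ := QuotientAddGroup.mk_surjective (F z₀)
  obtain ⟨G, ⟨-, hG⟩, -⟩ := (AddCircle.isCoveringMap_coe (1 : ℝ)).existsUnique_continuousMap_lifts
    ⟨U.domRestrict F, hF.domRestrict⟩ z₀ e₀ he₀
  refine ⟨fun z => if hz : z ∈ U then G ⟨z, hz⟩ else 0, ?_, fun z hz => ?_⟩
  · rw [continuousOn_iff_continuous_domRestrict]
    convert G.continuous using 1
    ext z
    simp
  · simp only [hz, dif_pos]
    exact congrFun hG ⟨z, hz⟩

/-- Two real-valued lifts of the same circle-valued map differ by a constant on a preconnected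
set. -/
theorem sub_eq_sub_of_coe_eq {E : Type*} [TopologicalSpace E] {R : Set E} (hR : IsPreconnected R)
    {θ H : E → ℝ} (hθ : ContinuousOn θ R) (hH : ContinuousOn H R)
    (h : ∀ z ∈ R, (θ z : AddCircle (1 : ℝ)) = H z) {c c' : E} (hc : c ∈ R) (hc' : c' ∈ R) :
    θ c' - θ c = H c' - H c := by
  have key : θ c' - H c' = θ c - H c :=
    (AddCircle.isCoveringMap_coe (1 : ℝ)).constOn_of_comp hR (hθ.sub hH)
      (fun x hx y hy => by
        rw [Pi.sub_apply, Pi.sub_apply, AddCircle.coe_sub, AddCircle.coe_sub, h x hx, h y hy,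
          sub_self, sub_self]) hc' hc
  linarith

theorem mem_meshRegion {S : Finset (ℤ × ℤ)} {z : ℝ × ℝ} :
    z ∈ meshRegion S ↔ ∃ q ∈ S, ((q.1 : ℝ) ≤ z.1 ∧ z.1 ≤ q.1 + 1) ∧
      ((q.2 : ℝ) ≤ z.2 ∧ z.2 ≤ q.2 + 1) := by
  simp only [meshRegion, unitSq, Set.mem_iUnion, Set.mem_prod, Set.mem_Icc, exists_prop]

/-- A point in the open square indexed by `q ∉ S` does not belong to the mesh region. -/
theorem notMem_meshRegion {S : Finset (ℤ × ℤ)} {q : ℤ × ℤ} (hq : q ∉ S) {z : ℝ × ℝ}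
    (h₁ : (q.1 : ℝ) < z.1) (h₂ : z.1 < q.1 + 1) (h₃ : (q.2 : ℝ) < z.2) (h₄ : z.2 < q.2 + 1) :
    z ∉ meshRegion S := by
  rw [mem_meshRegion]
  rintro ⟨⟨i, j⟩, hr, ⟨h₅, h₆⟩, h₇, h₈⟩
  have e₁ : (i : ℝ) < q.1 + 1 := by linarith
  have e₂ : (q.1 : ℝ) < i + 1 := by linarith
  have e₃ : (j : ℝ) < q.2 + 1 := by linarith
  have e₄ : (q.2 : ℝ) < j + 1 := by linarith
  norm_cast at e₁ e₂ e₃ e₄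
  have : ((i, j) : ℤ × ℤ) = q := Prod.ext (by simp; omega) (by simp; omega)
  exact hq (this ▸ hr)

/-- The horizontal segment between the centers of two horizontally adjacent squares of `S` lies in
the interior of the mesh region. -/
theorem horizontal_segment_subset {S : Finset (ℤ × ℤ)} {i j : ℤ} (h₁ : (i, j) ∈ S)
    (h₂ : (i + 1, j) ∈ S) :
    Set.Icc ((i : ℝ) + 1 / 2) (i + 1 + 1 / 2) ×ˢ {(j : ℝ) + 1 / 2} ⊆
      interior (meshRegion S) := by
  rintro ⟨x, y⟩ ⟨⟨hx₁, hx₂⟩, hy⟩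
  obtain rfl : y = j + 1 / 2 := hy
  refine mem_interior.2 ⟨Set.Ioo (i : ℝ) (i + 2) ×ˢ Set.Ioo (j : ℝ) (j + 1), ?_,
    isOpen_Ioo.prod isOpen_Ioo, ?_⟩
  · rintro ⟨x', y'⟩ ⟨⟨h₃, h₄⟩, h₅, h₆⟩
    simp only at h₃ h₄ h₅ h₆
    rw [mem_meshRegion]
    rcases le_total x' (i + 1) with h | h
    · exact ⟨_, h₁, ⟨h₃.le, h⟩, h₅.le, h₆.le⟩
    · exact ⟨_, h₂, ⟨by push_cast; exact h, by push_cast; linarith⟩, h₅.le, h₆.le⟩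
  · simp only at hx₁ hx₂
    exact ⟨⟨by simp only; linarith, by simp only; linarith⟩,
      by simp only; linarith, by simp only; linarith⟩

/-- The vertical segment between the centers of two vertically adjacent squares of `S` lies in
the interior of the mesh region. -/
theorem vertical_segment_subset {S : Finset (ℤ × ℤ)} {i j : ℤ} (h₁ : (i, j) ∈ S)
    (h₂ : (i, j + 1) ∈ S) :
    {(i : ℝ) + 1 / 2} ×ˢ Set.Icc ((j : ℝ) + 1 / 2) (j + 1 + 1 / 2) ⊆
      interior (meshRegion S) := by
  rintro ⟨x, y⟩ ⟨hx, hy₁, hy₂⟩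
  obtain rfl : x = i + 1 / 2 := hx
  refine mem_interior.2 ⟨Set.Ioo (i : ℝ) (i + 1) ×ˢ Set.Ioo (j : ℝ) (j + 2), ?_,
    isOpen_Ioo.prod isOpen_Ioo, ?_⟩
  · rintro ⟨x', y'⟩ ⟨⟨h₃, h₄⟩, h₅, h₆⟩
    simp only at h₃ h₄ h₅ h₆
    rw [mem_meshRegion]
    rcases le_total y' (j + 1) with h | h
    · exact ⟨_, h₁, ⟨h₃.le, h₄.le⟩, h₅.le, h⟩
    · exact ⟨_, h₂, ⟨h₃.le, h₄.le⟩, by push_cast; exact h, by push_cast; linarith⟩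
  · simp only at hy₁ hy₂
    exact ⟨⟨by simp only; linarith, by simp only; linarith⟩,
      by simp only; linarith, by simp only; linarith⟩

/-- A ramp which rises from `0` to `1` on the interval `[b + 1/2, b + 1]`. -/
noncomputable def ramp (b y : ℝ) : ℝ := min 1 (max 0 (2 * (y - b) - 1))

theorem ramp_of_le {b y : ℝ} (h : y ≤ b + 1 / 2) : ramp b y = 0 := by
  rw [ramp, max_eq_left (by linarith), min_eq_right zero_le_one]

theorem ramp_of_ge {b y : ℝ} (h : b + 1 ≤ y) : ramp b y = 1 := by
  rw [ramp, min_eq_left (le_max_of_le_right (by linarith))]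

theorem continuous_ramp (b : ℝ) : Continuous (ramp b) := by
  unfold ramp
  fun_prop

theorem ramp_center (b j : ℤ) : ramp b (j + 1 / 2) = if b + 1 ≤ j then 1 else 0 := by
  split_ifs with h
  · have : (b : ℝ) + 1 ≤ j := by exact_mod_cast h
    exact ramp_of_ge (by linarith)
  · have : (j : ℝ) ≤ b := by exact_mod_cast (by omega : j ≤ b)
    exact ramp_of_le (by linarith)

theorem coe_ramp_center (b j : ℤ) : (ramp b (j + 1 / 2) : AddCircle (1 : ℝ)) = 0 := by
  rw [ramp_center]
  split_ifs
  · exact AddCircle.coe_period 1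
  · rfl

/-- A circle-valued function winding once around the square indexed by `(a, b)`. -/
noncomputable def windingMap (a b : ℤ) (z : ℝ × ℝ) : AddCircle (1 : ℝ) :=
  if (a : ℝ) + 1 / 2 ≤ z.1 then (ramp b z.2 : AddCircle (1 : ℝ)) else 0

theorem continuousOn_windingMap {S : Finset (ℤ × ℤ)} {a b : ℤ} (hab : (a, b) ∉ S) :
    ContinuousOn (windingMap a b) (meshRegion S) := by
  rw [continuousOn_iff_continuous_domRestrict]
  refine Continuous.if_le (f' := fun z : meshRegion S => (ramp b z.1.2 : AddCircle (1 : ℝ)))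
    (g' := fun _ => 0) ?_ continuous_const continuous_const
    (continuous_fst.comp continuous_subtype_val) ?_
  · exact (AddCircle.continuous_mk' 1).comp
      ((continuous_ramp b).comp (continuous_snd.comp continuous_subtype_val))
  · rintro ⟨⟨x, y⟩, hz⟩ hx
    simp only at hx ⊢
    subst hx
    rcases le_or_gt y b with h | h
    · rw [ramp_of_le (by linarith)]
      rfl
    · rcases lt_or_ge y (b + 1) with h' | h'
      · exact absurd hz (notMem_meshRegion hab (by simp) (by simp; norm_num) h h')
      · rw [ramp_of_ge h']
        exact AddCircle.coe_period 1

/-- If the interior of the mesh region is simply connected, then for every square `(a, b) ∉ S`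
there is a function on the squares of `S` which jumps by one across the grid edges on the
horizontal ray starting at the vertex `(a, b + 1)`, and is locally constant otherwise. -/
theorem exists_jump {S : Finset (ℤ × ℤ)}
    (hsc : SimplyConnectedSpace ↥(interior (meshRegion S))) {a b : ℤ} (hab : (a, b) ∉ S) :
    ∃ φ : ℤ × ℤ → ℝ, (∀ q ∉ S, φ q = 0) ∧
      (∀ i j, (i, j) ∈ S → (i + 1, j) ∈ S → φ (i + 1, j) = φ (i, j)) ∧
      (∀ i j, (i, j) ∈ S → (i, j + 1) ∈ S →
        φ (i, j + 1) - φ (i, j) = if a ≤ i ∧ j = b then 1 else 0) := by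
  classical
  obtain ⟨θ, hθ, hlift⟩ := exists_continuousOn_lift isOpen_interior hsc
    ((continuousOn_windingMap hab).mono interior_subset)
  refine ⟨fun q => if q ∈ S then θ (q.1 + 1 / 2, q.2 + 1 / 2) else 0, fun q hq => if_neg hq,
    fun i j h₁ h₂ => ?_, fun i j h₁ h₂ => ?_⟩
  · simp only [h₁, h₂, if_true]
    have hsub := horizontal_segment_subset h₁ h₂
    have := sub_eq_sub_of_coe_eq (H := fun _ => 0)
      (isPreconnected_Icc.prod isPreconnected_singleton) (hθ.mono hsub) continuousOn_const
      (fun z hz => ?_) (c := ((i : ℝ) + 1 / 2, (j : ℝ) + 1 / 2))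
      (c' := ((i : ℝ) + 1 + 1 / 2, (j : ℝ) + 1 / 2)) ⟨by simp, by simp⟩ ⟨by simp, by simp⟩
    · push_cast
      linarith
    · rw [hlift z (hsub hz), windingMap, show z.2 = (j : ℝ) + 1 / 2 from hz.2, coe_ramp_center,
        ite_self]
      rfl
  · simp only [h₁, h₂, if_true]
    have hsub := vertical_segment_subset h₁ h₂
    have := sub_eq_sub_of_coe_eq (H := fun z => if a ≤ i then ramp b z.2 else 0)
      (isPreconnected_singleton.prod isPreconnected_Icc) (hθ.mono hsub) ?_
      (fun z hz => ?_) (c := ((i : ℝ) + 1 / 2, (j : ℝ) + 1 / 2))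
      (c' := ((i : ℝ) + 1 / 2, (j : ℝ) + 1 + 1 / 2)) ⟨by simp, by simp⟩ ⟨by simp, by simp⟩
    · have e := ramp_center b (j + 1)
      push_cast at e ⊢
      rw [this, ramp_center, e]
      by_cases h : a ≤ i
      · simp only [h, if_true, true_and]
        split_ifs <;> first | omega | norm_num
      · simp [h]
    · split_ifs
      · exact ((continuous_ramp b).comp continuous_snd).continuousOn
      · exact continuousOn_const
    · rw [hlift z (hsub hz), windingMap, show z.1 = (i : ℝ) + 1 / 2 from hz.1]
      simp only [add_le_add_iff_right, Int.cast_le]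
      split_ifs <;> simp

/-- The total difference of a finitely supported function under a permutation vanishes. -/
theorem finsum_comp_equiv_sub {α : Type*} (e : α ≃ α) {A : α → ℝ} (hA : A.support.Finite) :
    ∑ᶠ v, (A (e v) - A v) = 0 := by
  have hA' : (fun v => A (e v)).support.Finite := hA.preimage e.injective.injOn
  rw [finsum_sub_distrib hA' hA, finsum_comp_equiv e, sub_self]

/-- A function on the vertices which vanishes far to the right and is constant along all grid edges
which are not interior vanishes at the upper left corner of every square outside `S`. -/
theorem eq_zero_of_const_off_interior_edges {S : Finset (ℤ × ℤ)}
    (hsc : SimplyConnectedSpace ↥(interior (meshRegion S))) {u : ℤ × ℤ → ℝ} {N : ℤ}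
    (hN : ∀ v : ℤ × ℤ, N ≤ v.1 → u v = 0)
    (hh : ∀ v, ¬ hIntEdge S v → u (v.1 + 1, v.2) = u v)
    (hv : ∀ v, ¬ vIntEdge S v → u (v.1, v.2 + 1) = u v) {a b : ℤ} (hab : (a, b) ∉ S) :
    u (a, b + 1) = 0 := by
  classical
  obtain ⟨φ, hφ, hφx, hφy⟩ := exists_jump hsc hab
  have hfin : φ.support.Finite := S.finite_toSet.subset fun q hq => by
    by_contra h
    exact hq (hφ q h)
  let ex : ℤ × ℤ ≃ ℤ × ℤ := (Equiv.addRight 1).prodCongr (Equiv.refl ℤ)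
  let ey : ℤ × ℤ ≃ ℤ × ℤ := (Equiv.refl ℤ).prodCongr (Equiv.addRight 1)
  have hsup (e : ℤ × ℤ ≃ ℤ × ℤ) : (fun v => φ (e v)).support.Finite :=
    hfin.preimage e.injective.injOn
  let A : ℤ × ℤ → ℝ := fun v => u v * (φ (v.1 - 1, v.2) - φ (v.1 - 1, v.2 - 1))
  let B : ℤ × ℤ → ℝ := fun v => u v * (φ (v.1 - 1, v.2 - 1) - φ (v.1, v.2 - 1))
  let C : ℤ × ℤ → ℝ := fun v => if a ≤ v.1 ∧ v.2 = b + 1 then u v else 0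
  have hA : A.support.Finite := by
    refine ((hsup ex.symm).union (hsup (ex.symm.trans ey.symm))).subset fun v hv => ?_
    by_contra h
    simp only [Set.mem_union, Function.mem_support, not_or, not_not] at h
    apply hv
    have h₁ : φ (v.1 - 1, v.2) = 0 := h.1
    have h₂ : φ (v.1 - 1, v.2 - 1) = 0 := h.2
    simp [A, h₁, h₂]
  have hB : B.support.Finite := by
    refine ((hsup ey.symm).union (hsup (ex.symm.trans ey.symm))).subset fun v hv => ?_
    by_contra h
    simp only [Set.mem_union, Function.mem_support, not_or, not_not] at h
    apply hv
    have h₁ : φ (v.1, v.2 - 1) = 0 := h.1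
    have h₂ : φ (v.1 - 1, v.2 - 1) = 0 := h.2
    simp [B, h₁, h₂]
  have hC : C.support.Finite := by
    refine ((Set.finite_Icc a N).prod (Set.finite_singleton (b + 1))).subset fun v hv => ?_
    have h : a ≤ v.1 ∧ v.2 = b + 1 := by
      by_contra h
      exact hv (if_neg h)
    refine ⟨⟨h.1, ?_⟩, h.2⟩
    by_contra h'
    exact hv (by simp [C, hN v (by omega)])
  have hdiff (e : ℤ × ℤ ≃ ℤ × ℤ) {D : ℤ × ℤ → ℝ} (hD : D.support.Finite) :
      (fun v => D (e v) - D v).support.Finite := by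
    refine ((hD.preimage e.injective.injOn).union hD).subset fun v hv => ?_
    by_contra h
    simp only [Set.mem_union, Set.mem_preimage, Function.mem_support, not_or, not_not] at h
    exact hv (by simp [h.1, h.2])
  have key (v : ℤ × ℤ) : (A (ex v) - A v) + (B (ey v) - B v) - (C (ex v) - C v) =
      if v = (a - 1, b + 1) then - u (a, b + 1) else 0 := by
    obtain ⟨i, j⟩ := v
    have e₁ : (u (i + 1, j) - u (i, j)) * (φ (i, j) - φ (i, j - 1)) =
        (u (i + 1, j) - u (i, j)) * if a ≤ i ∧ j = b + 1 then 1 else 0 := by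
      by_cases h : hIntEdge S (i, j)
      · have := hφy i (j - 1) h.2 (by simpa using h.1)
        simp only [sub_add_cancel] at this
        simp only [this, sub_eq_iff_eq_add]
      · rw [hh _ h, sub_self, zero_mul, zero_mul]
    have e₂ : (u (i, j + 1) - u (i, j)) * (φ (i - 1, j) - φ (i, j)) = 0 := by
      by_cases h : vIntEdge S (i, j)
      · have := hφx (i - 1) j h.2 (by simpa using h.1)
        simp only [sub_add_cancel] at this
        rw [this, sub_self, mul_zero]
      · rw [hv _ h, sub_self, zero_mul]
    have e₃ : (A (ex (i, j)) - A (i, j)) + (B (ey (i, j)) - B (i, j)) =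
        (u (i + 1, j) - u (i, j)) * (φ (i, j) - φ (i, j - 1)) +
          (u (i, j + 1) - u (i, j)) * (φ (i - 1, j) - φ (i, j)) := by
      simp only [A, B, ex, ey, Equiv.prodCongr_apply, Prod.map, Equiv.coe_addRight,
        Equiv.refl_apply, add_sub_cancel_right]
      ring
    rw [e₃, e₁, e₂]
    simp only [C, ex, Equiv.prodCongr_apply, Prod.map, Equiv.coe_addRight, Equiv.refl_apply,
      Prod.mk.injEq]
    by_cases hj : j = b + 1
    · subst hj
      rcases lt_trichotomy i (a - 1) with h | h | h
      · simp [show ¬ a ≤ i by omega, show ¬ a ≤ i + 1 by omega, show i ≠ a - 1 by omega]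
      · subst h
        simp
      · simp [show a ≤ i by omega, show a ≤ i + 1 by omega, show i ≠ a - 1 by omega]
    · simp [hj]
  have total := finsum_congr key
  rw [finsum_sub_distrib (((hdiff ex hA).union (hdiff ey hB)).subset
      (Function.support_add _ _)) (hdiff ex hC),
    finsum_add_distrib (hdiff ex hA) (hdiff ey hB), finsum_comp_equiv_sub ex hA,
    finsum_comp_equiv_sub ey hB, finsum_comp_equiv_sub ex hC,
    finsum_eq_single _ (a - 1, b + 1) (fun v hv => if_neg hv), if_pos rfl] at total
  linarith

/-- A discrete closed one-form on `ℤ × ℤ` which vanishes far to the right is the differential of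
a function which vanishes far to the right. -/
theorem exists_potential {H V : ℤ × ℤ → ℝ} {N : ℤ} (hH : ∀ v : ℤ × ℤ, N ≤ v.1 → H v = 0)
    (hV : ∀ v : ℤ × ℤ, N ≤ v.1 → V v = 0)
    (hclosed : ∀ v : ℤ × ℤ, H v + V (v.1 + 1, v.2) = V v + H (v.1, v.2 + 1)) :
    ∃ u : ℤ × ℤ → ℝ, (∀ v : ℤ × ℤ, N ≤ v.1 → u v = 0) ∧
      (∀ v, u v - u (v.1 + 1, v.2) = H v) ∧ (∀ v, u v - u (v.1, v.2 + 1) = V v) := by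
  refine ⟨fun v => ∑ k ∈ Finset.range (N - v.1).toNat, H (v.1 + k, v.2), fun v hv => ?_,
    fun ⟨i, j⟩ => ?_, fun ⟨i, j⟩ => ?_⟩
  · simp [Int.toNat_of_nonpos (by omega : N - v.1 ≤ 0)]
  · rcases le_or_gt N i with h | h
    · simp [Int.toNat_of_nonpos (by omega : N - i ≤ 0),
        Int.toNat_of_nonpos (by omega : N - (i + 1) ≤ 0), hH (i, j) h]
    · simp only
      rw [show (N - i).toNat = (N - (i + 1)).toNat + 1 by omega, Finset.sum_range_succ']
      simp only [Nat.cast_add, Nat.cast_one, Nat.cast_zero, add_zero]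
      rw [Finset.sum_congr rfl fun k _ => by rw [show i + ((k : ℤ) + 1) = i + 1 + k by ring]]
      ring
  · have e : ∀ k : ℕ, H (i + k, j) - H (i + k, j + 1) =
        V (i + (k : ℕ), j) - V (i + ((k + 1 : ℕ) : ℤ), j) := fun k => by
      have := hclosed (i + k, j)
      simp only [add_assoc] at this
      push_cast
      linarith
    simp only
    rw [← Finset.sum_sub_distrib, Finset.sum_congr rfl fun k _ => e k,
      Finset.sum_range_sub' (fun k : ℕ => V (i + (k : ℤ), j)),
      hV (i + ((N - i).toNat : ℤ), j) (by simp only; omega)]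
    simp

/-- The checkerboard sign of a vertex. -/
def checkerSign (v : ℤ × ℤ) : ℝ := ((Int.negOnePow (v.1 + v.2) : ℤˣ) : ℤ)

theorem checkerSign_right (v : ℤ × ℤ) : checkerSign (v.1 + 1, v.2) = - checkerSign v := by
  simp [checkerSign, add_right_comm, Int.negOnePow_succ]

theorem checkerSign_up (v : ℤ × ℤ) : checkerSign (v.1, v.2 + 1) = - checkerSign v := by
  simp [checkerSign, ← add_assoc, Int.negOnePow_succ]

theorem checkerSign_mul_self (v : ℤ × ℤ) : checkerSign v * checkerSign v = 1 := by
  rw [checkerSign, ← Int.cast_mul, ← Units.val_mul, Int.units_mul_self]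
  simp

theorem exists_fst_bound (S : Finset (ℤ × ℤ)) : ∃ N : ℤ, ∀ v ∈ S, v.1 < N := by
  obtain ⟨M, hM⟩ := (S.image Prod.fst).bddAbove
  exact ⟨M + 1, fun v hv => Int.lt_add_one_of_le (hM (by
    simpa using ⟨v.2, hv⟩))⟩

/-- Let `W` be the space of real-valued functions on `ℤ × ℤ` supported on the
interior vertices of `S`, and let `X` be the space of real-valued functions on the interior
edges of `S` (encoded as a pair of functions on horizontal and vertical edges, vanishing off
the interior edges) such that for every square of `S`, with values on its boundary edges taken
to be `0`, the sum of the values at its bottom and top edges equals the sum of the values at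
its left and right edges.  Then the linear map `A : W → X`,
`(Aw)({v₁,v₂}) = (w(v₁) + w(v₂))/2` for each edge with endpoints `v₁, v₂`, is well defined and
is a bijection from `W` onto `X`. -/
theorem interpolation_bijective (S : Finset (ℤ × ℤ)) (hS : S.Nonempty)
    (hconn : IsConnected (interior (meshRegion S)))
    (hsc : SimplyConnectedSpace ↥(interior (meshRegion S))) :
    Set.BijOn
      (fun (w : ℤ × ℤ → ℝ) =>
        ((fun v : ℤ × ℤ => (w v + w (v.1 + 1, v.2)) / 2),
          (fun v : ℤ × ℤ => (w v + w (v.1, v.2 + 1)) / 2)))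
      {w : ℤ × ℤ → ℝ | ∀ v, ¬ interiorVertex S v → w v = 0}
      {p : (ℤ × ℤ → ℝ) × (ℤ × ℤ → ℝ) |
        (∀ v : ℤ × ℤ, ¬ hIntEdge S v → p.1 v = 0) ∧
        (∀ v : ℤ × ℤ, ¬ vIntEdge S v → p.2 v = 0) ∧
        ∀ q ∈ S, p.1 q + p.1 (q.1, q.2 + 1) = p.2 q + p.2 (q.1 + 1, q.2)} := by
  obtain ⟨N, hN⟩ := exists_fst_bound S
  refine ⟨fun w hw => ⟨fun v hv => ?_, fun v hv => ?_, fun q _ => ?_⟩, fun w hw w' hw' h => ?_,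
    fun p hp => ?_⟩
  · simp only
    rw [hw v fun h => hv ⟨h.2.2.2, h.2.2.1⟩,
      hw (v.1 + 1, v.2) fun h => hv ⟨by simpa using h.2.1, by simpa using h.1⟩]
    simp
  · simp only
    rw [hw v fun h => hv ⟨h.2.2.2, h.2.1⟩,
      hw (v.1, v.2 + 1) fun h => hv ⟨by simpa using h.2.2.1, by simpa using h.1⟩]
    simp
  · simp only
    ring
  · have hstep (v : ℤ × ℤ) : w v - w' v = -(w (v.1 + 1, v.2) - w' (v.1 + 1, v.2)) := by
      have := congrFun (congrArg Prod.fst h) v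
      simp only at this
      linarith
    have hzero (n : ℕ) : ∀ v : ℤ × ℤ, N ≤ v.1 + n → w v - w' v = 0 := by
      induction n with
      | zero =>
        intro v hv
        have hvS : ¬ interiorVertex S v := fun h => by
          have := hN v h.2.2.2
          simp at hv
          omega
        rw [hw v hvS, hw' v hvS, sub_zero]
      | succ n ih =>
        intro v hv
        rw [hstep, ih (v.1 + 1, v.2) (by push_cast at hv; simp only; omega), neg_zero]
    funext v
    exact sub_eq_zero.1 (hzero (N - v.1).toNat v (by omega))
  · obtain ⟨hp₁, hp₂, hp₃⟩ := hp
    have hclosed (q : ℤ × ℤ) :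
        p.1 q + p.1 (q.1, q.2 + 1) = p.2 q + p.2 (q.1 + 1, q.2) := by
      by_cases hq : q ∈ S
      · exact hp₃ q hq
      · rw [hp₁ q fun h => hq h.1, hp₂ q fun h => hq h.1,
          hp₁ (q.1, q.2 + 1) fun h => hq (by simpa using h.2),
          hp₂ (q.1 + 1, q.2) fun h => hq (by simpa using h.2)]
    obtain ⟨u, huN, hux, huy⟩ := exists_potential (N := N)
      (H := fun v => checkerSign v * (2 * p.1 v)) (V := fun v => checkerSign v * (2 * p.2 v))
      (fun v hv => by simp [hp₁ v fun h => absurd (hN v h.1) (by omega)])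
      (fun v hv => by simp [hp₂ v fun h => absurd (hN v h.1) (by omega)])
      (fun v => by
        simp only [checkerSign_right, checkerSign_up]
        linear_combination 2 * checkerSign v * hclosed v)
    have hh (v : ℤ × ℤ) (hv : ¬ hIntEdge S v) : u (v.1 + 1, v.2) = u v := by
      have := hux v
      simp only [hp₁ v hv, mul_zero] at this
      linarith
    have hv (v : ℤ × ℤ) (hv : ¬ vIntEdge S v) : u (v.1, v.2 + 1) = u v := by
      have := huy v
      simp only [hp₂ v hv, mul_zero] at this
      linarith
    have hzero {a b : ℤ} (hab : (a, b) ∉ S) : u (a, b + 1) = 0 :=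
      eq_zero_of_const_off_interior_edges hsc huN hh hv hab
    have hzero' {a b : ℤ} (hab : (a, b) ∉ S) : u (a, b) = 0 := by
      rw [← hv (a, b) fun h => hab h.1, hzero hab]
    refine ⟨fun v => checkerSign v * u v, fun v hvS => ?_, Prod.ext (funext fun v => ?_)
      (funext fun v => ?_)⟩
    · obtain ⟨i, j⟩ := v
      suffices u (i, j) = 0 by simp [this]
      simp only [interiorVertex, not_and_or] at hvS
      rcases hvS with h | h | h | h
      · have := hh (i - 1, j) fun h' => h h'.2
        simp only [sub_add_cancel] at this
        rw [this]
        simpa using hzero h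
      · have := hh (i - 1, j) fun h' => h h'.1
        simp only [sub_add_cancel] at this
        rw [this, hzero' h]
      · simpa using hzero h
      · exact hzero' h
    · simp only [checkerSign_right]
      linear_combination checkerSign v / 2 * hux v + p.1 v * checkerSign_mul_self v
    · simp only [checkerSign_up]
      linear_combination checkerSign v / 2 * huy v + p.2 v * checkerSign_mul_self v
end

section
/- Under the standing assumptions, the number of interior squares of S equals 2·(number of interior vertices of S) − (number of squares of S) + 2. -/
open Filter Topology

theorem unitSq_subset_meshRegion {S : Finset (ℤ × ℤ)} {q : ℤ × ℤ} (hq : q ∈ S) :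
    unitSq q ⊆ meshRegion S :=
  Set.subset_biUnion_of_mem (u := unitSq) hq

/-- A grid square containing a point of `Ω` belongs to the mesh. -/
theorem mem_of_mem_unitSq {S : Finset (ℤ × ℤ)} {x : ℝ × ℝ}
    (hx : x ∈ interior (meshRegion S)) {q : ℤ × ℤ} (hq : x ∈ unitSq q) : q ∈ S := by
  have hcl : x ∈ closure (Set.Ioo (q.1 : ℝ) (q.1 + 1) ×ˢ Set.Ioo (q.2 : ℝ) (q.2 + 1)) := by
    rw [closure_prod_eq, closure_Ioo (by simp), closure_Ioo (by simp)]
    exact hq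
  obtain ⟨y, hyS, hyq⟩ := mem_closure_iff.1 hcl _ isOpen_interior hx
  have hy := interior_subset hyS
  simp only [meshRegion, Set.mem_iUnion, unitSq, Set.mem_prod, Set.mem_Icc] at hy
  obtain ⟨r, hr, ⟨h1, h2⟩, h3, h4⟩ := hy
  simp only [Set.mem_prod, Set.mem_Ioo] at hyq
  obtain ⟨⟨k1, k2⟩, k3, k4⟩ := hyq
  have e1 : r.1 < q.1 + 1 := by exact_mod_cast h1.trans_lt k2
  have e2 : q.1 < r.1 + 1 := by exact_mod_cast k1.trans_le h2
  have e3 : r.2 < q.2 + 1 := by exact_mod_cast h3.trans_lt k4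
  have e4 : q.2 < r.2 + 1 := by exact_mod_cast k3.trans_le h4
  have : r = q := Prod.ext (by omega) (by omega)
  exact this ▸ hr

/-- A vertex which lies in `Ω` is interior. -/
theorem interiorVertex_of_mem_interior {S : Finset (ℤ × ℤ)} {p : ℤ × ℤ}
    (hp : ((p.1 : ℝ), (p.2 : ℝ)) ∈ interior (meshRegion S)) : interiorVertex S p := by
  refine ⟨mem_of_mem_unitSq hp ?_, mem_of_mem_unitSq hp ?_, mem_of_mem_unitSq hp ?_,
    mem_of_mem_unitSq hp ?_⟩ <;> simp [unitSq]

/-- The open rectangle formed by two horizontally adjacent squares. -/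
theorem Ioo_prod_subset_interior_of_right {S : Finset (ℤ × ℤ)} {i j : ℤ} (h : (i, j) ∈ S)
    (h' : (i + 1, j) ∈ S) :
    Set.Ioo (i : ℝ) (i + 2) ×ˢ Set.Ioo (j : ℝ) (j + 1) ⊆ interior (meshRegion S) := by
  refine interior_maximal ?_ (isOpen_Ioo.prod isOpen_Ioo)
  rintro ⟨x, y⟩ ⟨⟨h1, h2⟩, h3, h4⟩
  simp only at h1 h2 h3 h4
  rcases le_total x (i + 1) with hx | hx
  · exact unitSq_subset_meshRegion h ⟨⟨h1.le, hx⟩, h3.le, h4.le⟩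
  · refine unitSq_subset_meshRegion h' ⟨⟨?_, ?_⟩, h3.le, h4.le⟩ <;> push_cast <;> linarith

/-- The open rectangle formed by two vertically adjacent squares. -/
theorem Ioo_prod_subset_interior_of_up {S : Finset (ℤ × ℤ)} {i j : ℤ} (h : (i, j) ∈ S)
    (h' : (i, j + 1) ∈ S) :
    Set.Ioo (i : ℝ) (i + 1) ×ˢ Set.Ioo (j : ℝ) (j + 2) ⊆ interior (meshRegion S) := by
  refine interior_maximal ?_ (isOpen_Ioo.prod isOpen_Ioo)
  rintro ⟨x, y⟩ ⟨⟨h1, h2⟩, h3, h4⟩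
  simp only at h1 h2 h3 h4
  rcases le_total y (j + 1) with hy | hy
  · exact unitSq_subset_meshRegion h ⟨⟨h1.le, h2.le⟩, h3.le, hy⟩
  · refine unitSq_subset_meshRegion h' ⟨⟨h1.le, h2.le⟩, ?_, ?_⟩ <;> push_cast <;> linarith

theorem eventually_floor_eq_or (x : ℝ) :
    ∀ᶠ y in 𝓝 x, ⌊y⌋ = ⌊x⌋ ∨ ⌊y⌋ = ⌊x⌋ - 1 ∧ x = ⌊x⌋ := by
  rcases (Int.floor_le x).eq_or_lt with hx | hx
  · filter_upwards [Ioo_mem_nhds (sub_one_lt x) (lt_add_one x)] with y hy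
    have h1 : ⌊x⌋ - 1 ≤ ⌊y⌋ := Int.le_floor.2 (by push_cast; linarith [hy.1])
    have h2 : ⌊y⌋ < ⌊x⌋ + 1 := Int.floor_lt.2 (by push_cast; linarith [hy.2])
    have : ⌊y⌋ = ⌊x⌋ ∨ ⌊y⌋ = ⌊x⌋ - 1 := by omega
    exact this.imp_right fun h => ⟨h, hx.symm⟩
  · filter_upwards [Ioo_mem_nhds hx (Int.lt_floor_add_one x)] with y hy
    exact Or.inl (Int.floor_eq_iff.2 ⟨hy.1.le, hy.2⟩)

/-- A function on the squares of a mesh with connected `Ω` which takes equal values on squares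
sharing an edge is constant. -/
theorem eq_of_forall_adjacent {α : Type*} {S : Finset (ℤ × ℤ)}
    (hS : IsConnected (interior (meshRegion S))) {f : ℤ × ℤ → α}
    (hf₁ : ∀ i j, (i, j) ∈ S → (i + 1, j) ∈ S → f (i + 1, j) = f (i, j))
    (hf₂ : ∀ i j, (i, j) ∈ S → (i, j + 1) ∈ S → f (i, j + 1) = f (i, j))
    {q r : ℤ × ℤ} (hq : q ∈ S) (hr : r ∈ S) : f q = f r := by
  have := isPreconnected_iff_preconnectedSpace.1 hS.isPreconnected
  let F : interior (meshRegion S) → α := fun x => f (⌊x.1.1⌋, ⌊x.1.2⌋)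
  have hF : IsLocallyConstant F := by
    rw [IsLocallyConstant.iff_eventually_eq]
    rintro ⟨⟨x, y⟩, hxy⟩
    have hX : ∀ᶠ z : interior (meshRegion S) in 𝓝 ⟨(x, y), hxy⟩,
        ⌊z.1.1⌋ = ⌊x⌋ ∨ ⌊z.1.1⌋ = ⌊x⌋ - 1 ∧ x = ⌊x⌋ :=
      (continuous_subtype_val.fst.tendsto (⟨(x, y), hxy⟩ : interior (meshRegion S))).eventually
        (eventually_floor_eq_or x)
    have hY : ∀ᶠ z : interior (meshRegion S) in 𝓝 ⟨(x, y), hxy⟩,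
        ⌊z.1.2⌋ = ⌊y⌋ ∨ ⌊z.1.2⌋ = ⌊y⌋ - 1 ∧ y = ⌊y⌋ :=
      (continuous_subtype_val.snd.tendsto (⟨(x, y), hxy⟩ : interior (meshRegion S))).eventually
        (eventually_floor_eq_or y)
    filter_upwards [hX, hY] with z hzx hzy
    have mem : ∀ i j : ℤ, (i = ⌊x⌋ ∨ i = ⌊x⌋ - 1 ∧ x = ⌊x⌋) →
        (j = ⌊y⌋ ∨ j = ⌊y⌋ - 1 ∧ y = ⌊y⌋) → (i, j) ∈ S := by
      intro i j hi hj
      refine mem_of_mem_unitSq hxy ⟨?_, ?_⟩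
      · rcases hi with rfl | ⟨rfl, hi⟩
        · exact ⟨Int.floor_le x, (Int.lt_floor_add_one x).le⟩
        · constructor <;> push_cast <;> linarith
      · rcases hj with rfl | ⟨rfl, hj⟩
        · exact ⟨Int.floor_le y, (Int.lt_floor_add_one y).le⟩
        · constructor <;> push_cast <;> linarith
    have e₁ : f (⌊z.1.1⌋, ⌊z.1.2⌋) = f (⌊x⌋, ⌊z.1.2⌋) := by
      rcases id hzx with h | ⟨h, hx⟩
      · rw [h]
      · have := hf₁ (⌊x⌋ - 1) ⌊z.1.2⌋ (mem _ _ (.inr ⟨rfl, hx⟩) hzy)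
          (by simpa using mem _ _ (.inl rfl) hzy)
        rw [h, ← this, sub_add_cancel]
    have e₂ : f (⌊x⌋, ⌊z.1.2⌋) = f (⌊x⌋, ⌊y⌋) := by
      rcases id hzy with h | ⟨h, hy⟩
      · rw [h]
      · have := hf₂ ⌊x⌋ (⌊y⌋ - 1) (mem _ _ (.inl rfl) (.inr ⟨rfl, hy⟩))
          (by simpa using mem _ _ (.inl rfl) (.inl rfl))
        rw [h, ← this, sub_add_cancel]
    exact e₁.trans e₂
  have center : ∀ q ∈ S, ∃ x : interior (meshRegion S), F x = f q := by
    intro q hq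
    refine ⟨⟨(q.1 + 1 / 2, q.2 + 1 / 2), ?_⟩, ?_⟩
    · refine interior_mono (unitSq_subset_meshRegion hq) ?_
      rw [unitSq, interior_prod_eq, interior_Icc, interior_Icc]
      constructor <;> constructor <;> norm_num
    · have h : ⌊(2⁻¹ : ℝ)⌋ = 0 := by norm_num
      simp [F, h]
  obtain ⟨x, hx⟩ := center q hq
  obtain ⟨y, hy⟩ := center r hr
  rw [← hx, ← hy]
  exact hF.apply_eq_of_preconnectedSpace x y

/-- Two continuous branches of the logarithm of proportional functions have the same
increments. -/
theorem sub_eq_log_sub_log_of_exp_eq {X : Type*} [TopologicalSpace X] {T : Set X}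
    (hT : IsPreconnected T) {h w : X → ℂ} (hh : ContinuousOn h T) (hw : ContinuousOn w T)
    (hwT : ∀ z ∈ T, w z ∈ Complex.slitPlane) {c : ℂ} (hc : ∀ z ∈ T, Complex.exp (h z) = c * w z)
    {x y : X} (hx : x ∈ T) (hy : y ∈ T) :
    h y - h x = Complex.log (w y) - Complex.log (w x) := by
  have key : Set.EqOn h (fun z => Complex.log (w z) + (h x - Complex.log (w x))) T := by
    refine Complex.isCoveringMap_exp.eqOn_of_comp_eqOn hT hh
      ((hw.clog hwT).add continuousOn_const) ?_ hx (by ring)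
    intro z hz
    refine Subtype.ext ?_
    have hx0 := Complex.slitPlane_ne_zero (hwT x hx)
    have hz0 := Complex.slitPlane_ne_zero (hwT z hz)
    simp only [Function.comp_apply]
    rw [Complex.exp_add, Complex.exp_sub, Complex.exp_log hx0, Complex.exp_log hz0, hc z hz,
      hc x hx]
    field_simp
  have := key hy
  simp only at this
  rw [this]
  ring

/-- For a vertex `p` which is not interior, the cochain counting crossings of the horizontal ray
going right from `p` is a coboundary on the squares of a mesh with simply connected `Ω`. -/
theorem exists_ray_potential {S : Finset (ℤ × ℤ)}
    (hS : SimplyConnectedSpace (interior (meshRegion S))) {p : ℤ × ℤ}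
    (hp : ¬ interiorVertex S p) :
    ∃ g : ℤ × ℤ → ℝ, (∀ i j, (i, j) ∈ S → (i + 1, j) ∈ S → g (i + 1, j) = g (i, j)) ∧
      ∀ i j, (i, j) ∈ S → (i, j + 1) ∈ S →
        g (i, j + 1) - g (i, j) = if p.2 = j + 1 ∧ p.1 ≤ i then 1 else 0 := by
  let w : ℝ × ℝ → ℂ := fun z => ⟨p.1 - z.1, p.2 - z.2⟩
  have hw : Continuous w := by
    have : w = fun z => Complex.equivRealProdCLM.symm (p.1 - z.1, p.2 - z.2) := by
      rfl
    rw [this]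
    fun_prop
  obtain ⟨h, hc, hexp⟩ := Complex.exists_continuousOn_eqOn_exp_comp (g := w) hS isOpen_interior
    hw.continuousOn (by
      rintro ⟨z, hz, hz0⟩
      have h1 : (p.1 : ℝ) = z.1 := sub_eq_zero.1 (congrArg Complex.re hz0)
      have h2 : (p.2 : ℝ) = z.2 := sub_eq_zero.1 (congrArg Complex.im hz0)
      exact hp (interiorVertex_of_mem_interior (by rwa [h1, h2])))
  let c : ℤ × ℤ → ℝ × ℝ := fun q => (q.1 + 1 / 2, q.2 + 1 / 2)
  have hpi := Real.pi_pos
  refine ⟨fun q => ((h (c q)).im - (w (c q)).arg) / (2 * Real.pi), ?_, ?_⟩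
  · intro i j h₁ h₂
    have hsub := Ioo_prod_subset_interior_of_right h₁ h₂
    have hT := ((convex_Ioo (i : ℝ) (i + 2)).prod (convex_Ioo (j : ℝ) (j + 1))).isPreconnected
    have hm₁ : c (i, j) ∈ Set.Ioo (i : ℝ) (i + 2) ×ˢ Set.Ioo (j : ℝ) (j + 1) := by
      constructor <;> constructor <;> simp [c] <;> linarith
    have hm₂ : c (i + 1, j) ∈ Set.Ioo (i : ℝ) (i + 2) ×ˢ Set.Ioo (j : ℝ) (j + 1) := by
      constructor <;> constructor <;> simp [c] <;> linarith
    have key := sub_eq_log_sub_log_of_exp_eq hT (hc.mono hsub) hw.continuousOn (c := 1) (by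
      rintro ⟨x, y⟩ ⟨-, h3, h4⟩
      refine Or.inr fun h0 => ?_
      simp only [w] at h0 h3 h4
      have h5 : (p.2 : ℝ) = y := by linarith
      rw [← h5] at h3 h4
      have h3 : j < p.2 := by exact_mod_cast h3
      have h4 : p.2 < j + 1 := by exact_mod_cast h4
      omega) (fun z hz => by rw [one_mul]; exact hexp (hsub hz)) hm₁ hm₂
    have key := congrArg Complex.im key
    simp only [Complex.sub_im, Complex.log_im] at key
    dsimp only
    congr 1
    linarith
  · intro i j h₁ h₂
    have hsub := Ioo_prod_subset_interior_of_up h₁ h₂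
    have hT := ((convex_Ioo (i : ℝ) (i + 1)).prod (convex_Ioo (j : ℝ) (j + 2))).isPreconnected
    have hm₁ : c (i, j) ∈ Set.Ioo (i : ℝ) (i + 1) ×ˢ Set.Ioo (j : ℝ) (j + 2) := by
      constructor <;> constructor <;> simp [c] <;> linarith
    have hm₂ : c (i, j + 1) ∈ Set.Ioo (i : ℝ) (i + 1) ×ˢ Set.Ioo (j : ℝ) (j + 2) := by
      constructor <;> constructor <;> simp [c] <;> linarith
    rw [← sub_div]
    split_ifs with hcross
    · have key := sub_eq_log_sub_log_of_exp_eq hT (w := fun z => -w z) (hc.mono hsub)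
        hw.neg.continuousOn (c := -1) (by
        rintro ⟨x, y⟩ ⟨⟨h3, h4⟩, -⟩
        refine Or.inl ?_
        have : (p.1 : ℝ) ≤ i := by exact_mod_cast hcross.2
        simp only [w, Complex.neg_re] at h3 ⊢
        linarith) (fun z hz => by simpa using hexp (hsub hz)) hm₁ hm₂
      have key := congrArg Complex.im key
      simp only [Complex.sub_im, Complex.log_im] at key
      have h2 : (p.2 : ℝ) = j + 1 := by exact_mod_cast hcross.1
      have e₁ : (-w (c (i, j))).arg = (w (c (i, j))).arg - Real.pi :=
        Complex.arg_neg_eq_arg_sub_pi_of_im_pos (by simp [w, c, h2]; linarith)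
      have e₂ : (-w (c (i, j + 1))).arg = (w (c (i, j + 1))).arg + Real.pi :=
        Complex.arg_neg_eq_arg_add_pi_of_im_neg (by simp [w, c, h2])
      rw [e₁, e₂] at key
      rw [div_eq_one_iff_eq (by positivity)]
      linarith
    · have key := sub_eq_log_sub_log_of_exp_eq hT (hc.mono hsub) hw.continuousOn (c := 1) (by
        rintro ⟨x, y⟩ ⟨⟨h3, h4⟩, h5, h6⟩
        rw [Complex.mem_slitPlane_iff]
        by_contra! hneg
        simp only [w] at hneg h3 h4 h5 h6
        have hy : (p.2 : ℝ) = y := by linarith [hneg.2]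
        rw [← hy] at h5 h6
        have h5 : j < p.2 := by exact_mod_cast h5
        have h6 : p.2 < j + 2 := by exact_mod_cast h6
        have h7 : (p.1 : ℝ) < i + 1 := by linarith [hneg.1]
        have h7 : p.1 < i + 1 := by exact_mod_cast h7
        exact hcross ⟨by omega, by omega⟩)
        (fun z hz => by rw [one_mul]; exact hexp (hsub hz)) hm₁ hm₂
      have key := congrArg Complex.im key
      simp only [Complex.sub_im, Complex.log_im] at key
      rw [div_eq_zero_iff]
      left
      linarith

/-- The curl of a discrete one-cochain, with horizontal part `a` and vertical part `b`, around the
vertex `v`. -/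
def faceSum (a b : ℤ × ℤ → ℝ) (v : ℤ × ℤ) : ℝ :=
  a (v.1 - 1, v.2 - 1) + b (v.1, v.2 - 1) - a (v.1 - 1, v.2) - b (v.1 - 1, v.2 - 1)

/-- The squares of `S` whose right neighbour is in `S`. -/
def rightPairs (S : Finset (ℤ × ℤ)) : Finset (ℤ × ℤ) := S.filter fun q => (q.1 + 1, q.2) ∈ S

/-- The squares of `S` whose upper neighbour is in `S`. -/
def upPairs (S : Finset (ℤ × ℤ)) : Finset (ℤ × ℤ) := S.filter fun q => (q.1, q.2 + 1) ∈ S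

/-- The squares of `S` whose lower left corner is an interior vertex. -/
def interiorVertices (S : Finset (ℤ × ℤ)) : Finset (ℤ × ℤ) := S.filter fun v => interiorVertex S v

theorem sum_Ico_int_add_one {m i : ℤ} (h : m ≤ i) (f : ℤ → ℝ) :
    ∑ k ∈ Finset.Ico m (i + 1), f k = ∑ k ∈ Finset.Ico m i, f k + f i := by
  rw [← Finset.insert_Ico_right_eq_Ico_add_one h, Finset.sum_insert (by simp), add_comm]

/-- A cochain on the adjacent pairs of squares of `S` without curl at the interior vertices is a
coboundary. -/
theorem exists_potential_s7 {S : Finset (ℤ × ℤ)}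
    (hS : SimplyConnectedSpace (interior (meshRegion S))) {a b : ℤ × ℤ → ℝ}
    (ha : ∀ q ∉ S, a q = 0) (hb : ∀ q ∉ S, b q = 0)
    (hab : ∀ v, interiorVertex S v → faceSum a b v = 0) :
    ∃ f : ℤ × ℤ → ℝ, (∀ i j, (i, j) ∈ S → (i + 1, j) ∈ S → f (i + 1, j) - f (i, j) = a (i, j)) ∧
      ∀ i j, (i, j) ∈ S → (i, j + 1) ∈ S → f (i, j + 1) - f (i, j) = b (i, j) := by
  have hg : ∀ p, ∃ g : ℤ × ℤ → ℝ, ¬ interiorVertex S p →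
      (∀ i j, (i, j) ∈ S → (i + 1, j) ∈ S → g (i + 1, j) = g (i, j)) ∧
      ∀ i j, (i, j) ∈ S → (i, j + 1) ∈ S →
        g (i, j + 1) - g (i, j) = if p.2 = j + 1 ∧ p.1 ≤ i then 1 else 0 := by
    intro p
    by_cases hp : interiorVertex S p
    · exact ⟨0, fun h => absurd hp h⟩
    · obtain ⟨g, hg⟩ := exists_ray_potential hS hp
      exact ⟨g, fun _ => hg⟩
  choose g hg using hg
  obtain ⟨m, hm⟩ : ∃ m : ℤ, ∀ q ∈ S, m < q.1 := by
    obtain ⟨m, hm⟩ := (S.image Prod.fst).bddBelow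
    exact ⟨m - 1, fun q hq => by
      have := hm (Finset.mem_coe.2 (Finset.mem_image_of_mem Prod.fst hq))
      omega⟩
  set P := (S.biUnion cornersF).filter fun v => ¬ interiorVertex S v with hP
  have hsupp : ∀ v ∉ P, faceSum a b v = 0 := by
    intro v hv
    by_cases hi : interiorVertex S v
    · exact hab v hi
    · have hv' : ∀ q ∈ S, v ∉ cornersF q := fun q hq hvq =>
        hv (Finset.mem_filter.2 ⟨Finset.mem_biUnion.2 ⟨q, hq, hvq⟩, hi⟩)
      have h₁ : (v.1 - 1, v.2 - 1) ∉ S := fun h => hv' _ h (by simp [cornersF])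
      have h₂ : (v.1, v.2 - 1) ∉ S := fun h => hv' _ h (by simp [cornersF])
      have h₃ : (v.1 - 1, v.2) ∉ S := fun h => hv' _ h (by simp [cornersF])
      simp [faceSum, ha _ h₁, hb _ h₂, ha _ h₃, hb _ h₁]
  have hPm : ∀ p ∈ P, m < p.1 := by
    intro p hp
    obtain ⟨q, hq, hpq⟩ := Finset.mem_biUnion.1 (Finset.mem_filter.1 hp).1
    have := hm q hq
    simp only [cornersF, Finset.mem_insert, Finset.mem_singleton] at hpq
    rcases hpq with rfl | rfl | rfl | rfl <;> simp <;> omega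
  have stokes : ∀ j i, m ≤ i →
      b (i, j) - ∑ k ∈ Finset.Ico m i, (a (k, j + 1) - a (k, j)) =
        ∑ p ∈ P, faceSum a b p * if p.2 = j + 1 ∧ p.1 ≤ i then 1 else 0 := by
    intro j i hi
    induction i, hi using Int.leInduction with
    | base =>
      rw [hb _ fun h => lt_irrefl m (hm _ h), Finset.Ico_self, Finset.sum_empty, sub_zero]
      refine (Finset.sum_eq_zero fun p hp => ?_).symm
      rw [if_neg fun h => (hPm p hp).not_ge h.2, mul_zero]
    | succ i hi ih =>
      have hsplit : ∀ p : ℤ × ℤ,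
          (faceSum a b p * if p.2 = j + 1 ∧ p.1 ≤ i + 1 then (1 : ℝ) else 0) =
            (faceSum a b p * if p.2 = j + 1 ∧ p.1 ≤ i then 1 else 0) +
              if p = (i + 1, j + 1) then faceSum a b p else 0 := by
        intro p
        by_cases h : p = (i + 1, j + 1)
        · subst h
          simp
        · have : (p.2 = j + 1 ∧ p.1 ≤ i + 1) ↔ (p.2 = j + 1 ∧ p.1 ≤ i) := by
            rw [Prod.ext_iff] at h
            simp only at h
            omega
          simp [h, this]
      have hlast : (∑ p ∈ P, if p = (i + 1, j + 1) then faceSum a b p else 0) =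
          faceSum a b (i + 1, j + 1) := by
        rw [Finset.sum_ite_eq']
        split_ifs with h
        · rfl
        · exact (hsupp _ h).symm
      rw [Finset.sum_congr rfl fun p _ => hsplit p, Finset.sum_add_distrib, hlast, ← ih,
        sum_Ico_int_add_one hi]
      simp only [faceSum, add_sub_cancel_right]
      ring
  refine ⟨fun q => ∑ k ∈ Finset.Ico m q.1, a (k, q.2) + ∑ p ∈ P, faceSum a b p * g p q, ?_, ?_⟩
  · intro i j h₁ h₂
    have : ∑ p ∈ P, faceSum a b p * g p (i + 1, j) = ∑ p ∈ P, faceSum a b p * g p (i, j) :=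
      Finset.sum_congr rfl fun p hp => by
        rw [(hg p (Finset.mem_filter.1 hp).2).1 i j h₁ h₂]
    simp only [this, sum_Ico_int_add_one (hm _ h₁).le]
    ring
  · intro i j h₁ h₂
    have hs := stokes j i (hm _ h₁).le
    have : ∑ p ∈ P, faceSum a b p * g p (i, j + 1) - ∑ p ∈ P, faceSum a b p * g p (i, j) =
        ∑ p ∈ P, faceSum a b p * if p.2 = j + 1 ∧ p.1 ≤ i then 1 else 0 := by
      rw [← Finset.sum_sub_distrib]
      refine Finset.sum_congr rfl fun p hp => ?_
      rw [← mul_sub, (hg p (Finset.mem_filter.1 hp).2).2 i j h₁ h₂]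
    rw [Finset.sum_sub_distrib] at hs
    simp only
    linarith

/-- Extension by zero of a function on a finite set. -/
noncomputable def extendZero (T : Finset (ℤ × ℤ)) : (T → ℝ) →ₗ[ℝ] (ℤ × ℤ → ℝ) :=
  Function.ExtendByZero.linearMap ℝ (Subtype.val : T → ℤ × ℤ)

theorem extendZero_of_mem {T : Finset (ℤ × ℤ)} (f : T → ℝ) {q : ℤ × ℤ} (hq : q ∈ T) :
    extendZero T f q = f ⟨q, hq⟩ :=
  Subtype.val_injective.extend_apply f 0 ⟨q, hq⟩

theorem extendZero_of_notMem {T : Finset (ℤ × ℤ)} (f : T → ℝ) {q : ℤ × ℤ} (hq : q ∉ T) :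
    extendZero T f q = 0 :=
  Function.extend_apply' (f := (Subtype.val : T → ℤ × ℤ)) f 0 q fun ⟨x, hx⟩ => hq (hx ▸ x.2)

/-- The coboundary from functions on squares to functions on adjacent pairs. -/
noncomputable def gradMap (S : Finset (ℤ × ℤ)) :
    (S → ℝ) →ₗ[ℝ] (rightPairs S → ℝ) × (upPairs S → ℝ) where
  toFun f := (fun q => extendZero S f (q.1.1 + 1, q.1.2) - extendZero S f q.1,
    fun q => extendZero S f (q.1.1, q.1.2 + 1) - extendZero S f q.1)
  map_add' f g := by
    ext q <;> simp <;> ring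
  map_smul' c f := by
    ext q <;> simp <;> ring

/-- The coboundary from functions on adjacent pairs to functions on interior vertices. -/
noncomputable def curlMap (S : Finset (ℤ × ℤ)) :
    (rightPairs S → ℝ) × (upPairs S → ℝ) →ₗ[ℝ] (interiorVertices S → ℝ) where
  toFun c v := faceSum (extendZero _ c.1) (extendZero _ c.2) v.1
  map_add' c d := by
    ext v
    simp only [faceSum, Prod.fst_add, Prod.snd_add, map_add, Pi.add_apply]
    ring
  map_smul' r c := by
    ext v
    simp only [faceSum, Prod.smul_fst, Prod.smul_snd, map_smul, Pi.smul_apply, smul_eq_mul,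
      RingHom.id_apply]
    ring

theorem mem_rightPairs {S : Finset (ℤ × ℤ)} {q : ℤ × ℤ} :
    q ∈ rightPairs S ↔ q ∈ S ∧ (q.1 + 1, q.2) ∈ S := Finset.mem_filter

theorem mem_upPairs {S : Finset (ℤ × ℤ)} {q : ℤ × ℤ} :
    q ∈ upPairs S ↔ q ∈ S ∧ (q.1, q.2 + 1) ∈ S := Finset.mem_filter

theorem mem_interiorVertices {S : Finset (ℤ × ℤ)} {v : ℤ × ℤ} :
    v ∈ interiorVertices S ↔ interiorVertex S v :=
  Finset.mem_filter.trans ⟨fun h => h.2, fun h => ⟨h.2.2.2, h⟩⟩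

/-- The four adjacent pairs around an interior vertex. -/
theorem pairs_of_interiorVertex {S : Finset (ℤ × ℤ)} {v : ℤ × ℤ} (hv : interiorVertex S v) :
    (v.1 - 1, v.2 - 1) ∈ rightPairs S ∧ (v.1, v.2 - 1) ∈ upPairs S ∧
      (v.1 - 1, v.2) ∈ rightPairs S ∧ (v.1 - 1, v.2 - 1) ∈ upPairs S := by
  obtain ⟨h₁, h₂, h₃, h₄⟩ := hv
  simp only [mem_rightPairs, mem_upPairs, sub_add_cancel]
  exact ⟨⟨h₁, h₃⟩, ⟨h₃, h₄⟩, ⟨h₂, h₄⟩, h₁, h₂⟩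

theorem curlMap_surjective (S : Finset (ℤ × ℤ)) : Function.Surjective (curlMap S) := by
  rw [← LinearMap.range_eq_top, eq_top_iff, ← (Pi.basisFun ℝ (interiorVertices S)).span_eq,
    Submodule.span_le]
  rintro _ ⟨p, rfl⟩
  refine ⟨(0, fun q => if p.1.2 = q.1.2 + 1 ∧ p.1.1 ≤ q.1.1 then 1 else 0), ?_⟩
  ext v
  obtain ⟨-, h₂, -, h₄⟩ := pairs_of_interiorVertex (mem_interiorVertices.1 v.2)
  simp only [curlMap, LinearMap.coe_mk, AddHom.coe_mk, faceSum, map_zero, Pi.zero_apply,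
    extendZero_of_mem _ h₂, extendZero_of_mem _ h₄, Pi.basisFun_apply, Pi.single_apply,
    sub_add_cancel]
  by_cases h : v = p
  · subst h
    simp
  · have h' : ¬ (v.1.1 = p.1.1 ∧ v.1.2 = p.1.2) := fun h' => h (Subtype.ext (Prod.ext h'.1 h'.2))
    have : (p.1.2 = v.1.2 ∧ p.1.1 ≤ v.1.1) ↔ (p.1.2 = v.1.2 ∧ p.1.1 ≤ v.1.1 - 1) := by omega
    simp [h, this]

theorem range_gradMap_eq_ker_curlMap {S : Finset (ℤ × ℤ)}
    (hS : SimplyConnectedSpace (interior (meshRegion S))) :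
    LinearMap.range (gradMap S) = LinearMap.ker (curlMap S) := by
  apply le_antisymm
  · rintro _ ⟨f, rfl⟩
    rw [LinearMap.mem_ker]
    ext v
    obtain ⟨h₁, h₂, h₃, h₄⟩ := pairs_of_interiorVertex (mem_interiorVertices.1 v.2)
    simp [curlMap, gradMap, faceSum, extendZero_of_mem _ h₁, extendZero_of_mem _ h₂,
      extendZero_of_mem _ h₃, extendZero_of_mem _ h₄]
  · rintro ⟨a, b⟩ hab
    obtain ⟨f, hf₁, hf₂⟩ := exists_potential_s7 hS (a := extendZero _ a) (b := extendZero _ b)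
      (fun q hq => extendZero_of_notMem _ fun h => hq (mem_rightPairs.1 h).1)
      (fun q hq => extendZero_of_notMem _ fun h => hq (mem_upPairs.1 h).1)
      (fun v hv => congrFun hab ⟨v, mem_interiorVertices.2 hv⟩)
    refine ⟨fun q => f q, ?_⟩
    ext q
    · obtain ⟨h₁, h₂⟩ := mem_rightPairs.1 q.2
      have := hf₁ _ _ h₁ h₂
      rw [extendZero_of_mem _ q.2] at this
      simpa [gradMap, extendZero_of_mem _ h₁, extendZero_of_mem _ h₂] using this
    · obtain ⟨h₁, h₂⟩ := mem_upPairs.1 q.2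
      have := hf₂ _ _ h₁ h₂
      rw [extendZero_of_mem _ q.2] at this
      simpa [gradMap, extendZero_of_mem _ h₁, extendZero_of_mem _ h₂] using this

theorem finrank_ker_gradMap {S : Finset (ℤ × ℤ)} (hne : S.Nonempty)
    (hS : IsConnected (interior (meshRegion S))) :
    Module.finrank ℝ (LinearMap.ker (gradMap S)) = 1 := by
  obtain ⟨r, hr⟩ := hne
  have hone : (1 : S → ℝ) ∈ LinearMap.ker (gradMap S) := by
    rw [LinearMap.mem_ker]
    ext q
    · obtain ⟨h₁, h₂⟩ := mem_rightPairs.1 q.2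
      simp [gradMap, extendZero_of_mem _ h₁, extendZero_of_mem _ h₂]
    · obtain ⟨h₁, h₂⟩ := mem_upPairs.1 q.2
      simp [gradMap, extendZero_of_mem _ h₁, extendZero_of_mem _ h₂]
  refine finrank_eq_one (⟨_, hone⟩ : LinearMap.ker (gradMap S)) ?_ ?_
  · intro h
    exact one_ne_zero (congrFun (congrArg Subtype.val h) ⟨r, hr⟩)
  · rintro ⟨f, hf⟩
    refine ⟨f ⟨r, hr⟩, Subtype.ext (funext fun q => ?_)⟩
    have hf₁ := fun q => congrFun (congrArg Prod.fst (LinearMap.mem_ker.1 hf)) q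
    have hf₂ := fun q => congrFun (congrArg Prod.snd (LinearMap.mem_ker.1 hf)) q
    have := eq_of_forall_adjacent hS (f := extendZero S f)
      (fun i j h₁ h₂ => sub_eq_zero.1 (hf₁ ⟨(i, j), mem_rightPairs.2 ⟨h₁, h₂⟩⟩))
      (fun i j h₁ h₂ => sub_eq_zero.1 (hf₂ ⟨(i, j), mem_upPairs.2 ⟨h₁, h₂⟩⟩)) hr q.2
    rw [extendZero_of_mem _ hr, extendZero_of_mem _ q.2] at this
    simpa using this

/-- Euler's formula for the cell decomposition of `Ω`. -/
theorem card_add_card_interiorVertices {S : Finset (ℤ × ℤ)} (hne : S.Nonempty)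
    (hc : IsConnected (interior (meshRegion S)))
    (hS : SimplyConnectedSpace (interior (meshRegion S))) :
    S.card + (interiorVertices S).card = (rightPairs S).card + (upPairs S).card + 1 := by
  have h₁ := (gradMap S).finrank_range_add_finrank_ker
  have h₂ := (curlMap S).finrank_range_add_finrank_ker
  rw [finrank_ker_gradMap hne hc, range_gradMap_eq_ker_curlMap hS] at h₁
  rw [LinearMap.range_eq_top.2 (curlMap_surjective S), finrank_top] at h₂
  simp only [Module.finrank_prod, Module.finrank_fintype_fun_eq_card, Fintype.card_coe] at h₁ h₂
  omega

theorem card_filter_interiorVertex_add (S : Finset (ℤ × ℤ)) {d e : ℤ} (hd : d = 0 ∨ d = 1)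
    (he : e = 0 ∨ e = 1) :
    (S.filter fun q => interiorVertex S (q.1 + d, q.2 + e)).card = (interiorVertices S).card := by
  refine Finset.card_bij (fun q _ => (q.1 + d, q.2 + e)) ?_ ?_ ?_
  · intro q hq
    exact mem_interiorVertices.2 (Finset.mem_filter.1 hq).2
  · intro q _ r _ h
    rw [Prod.ext_iff] at h ⊢
    simpa using h
  · intro v hv
    have hv := mem_interiorVertices.1 hv
    refine ⟨(v.1 - d, v.2 - e), Finset.mem_filter.2 ⟨?_, by simpa using hv⟩, by simp⟩
    obtain ⟨h₁, h₂, h₃, h₄⟩ := hv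
    rcases hd with rfl | rfl <;> rcases he with rfl | rfl <;> simpa

theorem card_filter_left (S : Finset (ℤ × ℤ)) :
    (S.filter fun q => (q.1 - 1, q.2) ∈ S).card = (rightPairs S).card := by
  refine Finset.card_bij (fun q _ => (q.1 - 1, q.2)) ?_ ?_ ?_
  · intro q hq
    simpa [mem_rightPairs, and_comm] using hq
  · intro q _ r _ h
    rw [Prod.ext_iff] at h ⊢
    simpa using h
  · intro q hq
    refine ⟨(q.1 + 1, q.2), ?_, by simp⟩
    simpa [mem_rightPairs, and_comm] using hq

theorem card_filter_down (S : Finset (ℤ × ℤ)) :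
    (S.filter fun q => (q.1, q.2 - 1) ∈ S).card = (upPairs S).card := by
  refine Finset.card_bij (fun q _ => (q.1, q.2 - 1)) ?_ ?_ ?_
  · intro q hq
    simpa [mem_upPairs, and_comm] using hq
  · intro q _ r _ h
    rw [Prod.ext_iff] at h ⊢
    simpa using h
  · intro q hq
    refine ⟨(q.1, q.2 + 1), ?_, by simp⟩
    simpa [mem_upPairs, and_comm] using hq

/-- The possible incidences of the interior corners `A` (lower left), `B` (lower right),
`C` (upper left), `E` (upper right) and the neighbours `R`, `L`, `U`, `D` of a square. -/
theorem indicator_corners_eq {A B C E R L U D : Prop} [Decidable A] [Decidable B] [Decidable C]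
    [Decidable E] [Decidable R] [Decidable L] [Decidable U] [Decidable D]
    (hA : A → L ∧ D) (hB : B → R ∧ D) (hC : C → L ∧ U) (hE : E → R ∧ U)
    (hD : D → A ∨ B) (hL : L → A ∨ C) (hU : U → C ∨ E) (hR : R → B ∨ E)
    (h₀ : ¬ (¬ A ∧ ¬ B ∧ ¬ C ∧ ¬ E)) (h₁ : ¬ (¬ A ∧ ¬ E ∧ B ∧ C)) (h₂ : ¬ (¬ B ∧ ¬ C ∧ A ∧ E)) :
    (if A ∧ B ∧ C ∧ E then 1 else 0 : ℤ) =
      (if A then 1 else 0) + (if B then 1 else 0) + (if C then 1 else 0) +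
        (if E then 1 else 0) + 1 -
        ((if R then 1 else 0) + (if L then 1 else 0) + (if U then 1 else 0) +
          (if D then 1 else 0)) := by
  by_cases A <;> by_cases B <;> by_cases C <;> by_cases E <;> simp_all

/-- On each square, the number of interior corners exceeds the number of neighbouring squares by
`-1`, or by `0` if the square is interior. -/
theorem interiorSquare_indicator {S : Finset (ℤ × ℤ)} (h : Standing S) {q : ℤ × ℤ} (hq : q ∈ S) :
    (if interiorSquare S q then 1 else 0 : ℤ) =
      (if interiorVertex S (q.1 + 0, q.2 + 0) then 1 else 0) +
        (if interiorVertex S (q.1 + 1, q.2 + 0) then 1 else 0) +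
        (if interiorVertex S (q.1 + 0, q.2 + 1) then 1 else 0) +
        (if interiorVertex S (q.1 + 1, q.2 + 1) then 1 else 0) + 1 -
        ((if (q.1 + 1, q.2) ∈ S then 1 else 0) + (if (q.1 - 1, q.2) ∈ S then 1 else 0) +
          (if (q.1, q.2 + 1) ∈ S then 1 else 0) + (if (q.1, q.2 - 1) ∈ S then 1 else 0)) := by
  obtain ⟨i, j⟩ := q
  have m₁ : meshVertex S (i, j) := .inr (.inr (.inr hq))
  have m₂ : meshVertex S (i + 1, j) := .inr (.inl (by simpa using hq))
  have m₃ : meshVertex S (i, j + 1) := .inr (.inr (.inl (by simpa using hq)))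
  have m₄ : meshVertex S (i + 1, j + 1) := .inl (by simpa using hq)
  have f₁ := h.noFourBoundary _ hq
  have f₂ := h.noDiagOne _ hq
  have f₃ := h.noDiagTwo _ hq
  have e₁ := h.edgeH _ hq
  have e₂ := h.edgeV _ hq
  have e₃ := h.edgeH (i, j + 1)
  have e₄ := h.edgeV (i + 1, j)
  have n₁ : interiorVertex S (i, j) → (i - 1, j) ∈ S ∧ (i, j - 1) ∈ S := fun h => ⟨h.2.1, h.2.2.1⟩
  have n₂ : interiorVertex S (i + 1, j) → (i + 1, j) ∈ S ∧ (i, j - 1) ∈ S := fun h =>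
    ⟨h.2.2.2, by simpa using h.1⟩
  have n₃ : interiorVertex S (i, j + 1) → (i - 1, j) ∈ S ∧ (i, j + 1) ∈ S := fun h =>
    ⟨by simpa using h.1, h.2.2.2⟩
  have n₄ : interiorVertex S (i + 1, j + 1) → (i + 1, j) ∈ S ∧ (i, j + 1) ∈ S := fun h =>
    ⟨by simpa using h.2.2.1, by simpa using h.2.1⟩
  simp only [boundaryVertex, m₁, m₂, m₃, m₄, true_and, add_sub_cancel_right, hq,
    forall_true_left] at f₁ f₂ f₃ e₁ e₂ e₃ e₄
  simp only [add_zero]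
  exact indicator_corners_eq n₁ n₂ n₃ n₄ e₁ e₂ e₃ e₄ f₁ f₂ f₃
/-- Under the standing assumptions, the number of interior squares of `S`
equals `2·(number of interior vertices of S) − (number of squares of S) + 2`. -/
theorem card_interior_squares (S : Finset (ℤ × ℤ)) (h : Standing S) :
    ((S.filter fun q => interiorSquare S q).card : ℤ) =
      2 * (((S.biUnion cornersF).filter fun v => interiorVertex S v).card : ℤ) -
        (S.card : ℤ) + 2 := by
  have hV : (S.biUnion cornersF).filter (fun v => interiorVertex S v) = interiorVertices S := by
    ext v
    rw [mem_interiorVertices, Finset.mem_filter, and_iff_right_iff_imp]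
    exact fun hv => Finset.mem_biUnion.2 ⟨v, hv.2.2.2, by simp [cornersF]⟩
  have hEuler := card_add_card_interiorVertices h.nonempty h.connected h.simplyConnected
  have hsum := Finset.sum_congr rfl fun q hq => interiorSquare_indicator h (q := q) hq
  simp only [Finset.sum_add_distrib, Finset.sum_sub_distrib, Finset.sum_boole, Finset.sum_const,
    card_filter_left, card_filter_down] at hsum
  rw [card_filter_interiorVertex_add S (.inl rfl) (.inl rfl),
    card_filter_interiorVertex_add S (.inr rfl) (.inl rfl),
    card_filter_interiorVertex_add S (.inl rfl) (.inr rfl),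
    card_filter_interiorVertex_add S (.inr rfl) (.inr rfl)] at hsum
  have hR : (S.filter fun q => (q.1 + 1, q.2) ∈ S).card = (rightPairs S).card := rfl
  have hU : (S.filter fun q => (q.1, q.2 + 1) ∈ S).card = (upPairs S).card := rfl
  rw [hR, hU, nsmul_one] at hsum
  rw [hV, hsum]
  omega
end

section
/- Under the standing assumptions, the kernel of the linear map c ↦ Dc, defined on the space of functions c : ℤ×ℤ → ℝ×ℝ supported on the interior vertices, has dimension (as a real vector space) equal to the number of interior squares of S. -/
/-- The locally divergence-free space: functions `c : ℤ × ℤ → ℝ × ℝ` supported on the interior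
vertices of `S` whose discrete divergence vanishes on every square of `S`. -/
def kerD (S : Finset (ℤ × ℤ)) : Submodule ℝ ((ℤ × ℤ) → ℝ × ℝ) where
  carrier := {c | (∀ v : ℤ × ℤ, ¬ interiorVertex S v → c v = 0) ∧ ∀ q ∈ S, Ddiv c q = 0}
  add_mem' := by
    rintro a b ⟨ha1, ha2⟩ ⟨hb1, hb2⟩
    refine ⟨fun v hv => by simp [ha1 v hv, hb1 v hv], fun q hq => ?_⟩
    have h1 := ha2 q hq
    have h2 := hb2 q hq
    simp only [Ddiv, dX, dY, Pi.add_apply, Prod.fst_add, Prod.snd_add] at *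
    linarith
  zero_mem' := by
    refine ⟨fun v _ => rfl, fun q hq => ?_⟩
    simp [Ddiv, dX, dY]
  smul_mem' := by
    rintro r a ⟨ha1, ha2⟩
    refine ⟨fun v hv => by simp [ha1 v hv], fun q hq => ?_⟩
    have h1 := ha2 q hq
    simp only [Ddiv, dX, dY, Pi.smul_apply, Prod.smul_fst, Prod.smul_snd,
      smul_eq_mul] at *
    linear_combination r * h1

/-- Two continuous logarithms of the same function on a preconnected set differ by a constant. -/
theorem sub_eq_sub_of_exp_eqOn {X : Type*} [TopologicalSpace X] {R : Set X}
    (hR : IsPreconnected R) {L M : X → ℂ} (hL : ContinuousOn L R) (hM : ContinuousOn M R)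
    (he : ∀ x ∈ R, Complex.exp (L x) = Complex.exp (M x)) {a b : X} (ha : a ∈ R) (hb : b ∈ R) :
    L a - M a = L b - M b := by
  have key := Complex.isCoveringMap_exp.eqOn_of_comp_eqOn hR (g₁ := L)
    (g₂ := fun x => M x + (L a - M a)) hL (by fun_prop) (fun x hx => Subtype.ext ?_) ha (by ring) hb
  · simp only [key]; ring
  · simp [Complex.exp_add, Complex.exp_sub, he x hx, he a ha]

/-- The displacement from the lattice point `k` to `z`, as a complex number. -/
def displacement (k : ℤ × ℤ) (z : ℝ × ℝ) : ℂ := ⟨z.1 - k.1, z.2 - k.2⟩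

theorem continuous_displacement (k : ℤ × ℤ) : Continuous (displacement k) := by
  have : displacement k =
      fun z => ((z.1 - k.1 : ℝ) : ℂ) + ((z.2 - k.2 : ℝ) : ℂ) * Complex.I := by
    ext z
    exact Complex.mk_eq_add_mul_I _ _
  rw [this]
  fun_prop

/-- The centre of the square indexed by `q`. -/
noncomputable def center (q : ℤ × ℤ) : ℝ × ℝ := (q.1 + 1 / 2, q.2 + 1 / 2)

/-- The open rectangle with lower left corner `(a, b)` and upper right corner `(c, d)`. -/
def openRect (a b c d : ℤ) : Set (ℝ × ℝ) := Set.Ioo (a : ℝ) c ×ˢ Set.Ioo (b : ℝ) d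

theorem isOpen_openRect (a b c d : ℤ) : IsOpen (openRect a b c d) := isOpen_Ioo.prod isOpen_Ioo

theorem isPreconnected_openRect (a b c d : ℤ) : IsPreconnected (openRect a b c d) :=
  isPreconnected_Ioo.prod isPreconnected_Ioo

theorem coe_notMem_interior_meshRegion {S : Finset (ℤ × ℤ)} {k : ℤ × ℤ}
    (hk : ¬ interiorVertex S k) :
    ((k.1 : ℝ), (k.2 : ℝ)) ∉ interior (meshRegion S) := by
  have key : ∀ q : ℤ × ℤ, q ∉ S → (q.1 = k.1 ∨ q.1 = k.1 - 1) → (q.2 = k.2 ∨ q.2 = k.2 - 1) →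
      ((k.1 : ℝ), (k.2 : ℝ)) ∈ closure (meshRegion S)ᶜ := by
    intro q hq h1 h2
    have hsub : openRect q.1 q.2 (q.1 + 1) (q.2 + 1) ⊆ (meshRegion S)ᶜ := by
      rintro ⟨x, y⟩ ⟨⟨hx1, hx2⟩, hy1, hy2⟩ hz
      simp only [meshRegion, Set.mem_iUnion, unitSq] at hz
      obtain ⟨p, hp, ⟨hx3, hx4⟩, hy3, hy4⟩ := hz
      apply hq
      have e1 : q.1 = p.1 := by
        have a1 : (p.1 : ℝ) < ((q.1 + 1 : ℤ) : ℝ) := lt_of_le_of_lt hx3 hx2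
        have a2 : (q.1 : ℝ) < ((p.1 + 1 : ℤ) : ℝ) := by push_cast; exact lt_of_lt_of_le hx1 hx4
        have := Int.cast_lt.1 a1
        have := Int.cast_lt.1 a2
        omega
      have e2 : q.2 = p.2 := by
        have a1 : (p.2 : ℝ) < ((q.2 + 1 : ℤ) : ℝ) := lt_of_le_of_lt hy3 hy2
        have a2 : (q.2 : ℝ) < ((p.2 + 1 : ℤ) : ℝ) := by push_cast; exact lt_of_lt_of_le hy1 hy4
        have := Int.cast_lt.1 a1
        have := Int.cast_lt.1 a2
        omega
      rwa [Prod.ext e1 e2]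
    refine closure_mono hsub ?_
    rw [openRect, closure_prod_eq, closure_Ioo (by simp), closure_Ioo (by simp)]
    rcases h1 with h1 | h1 <;> rcases h2 with h2 | h2 <;> simp [h1, h2]
  rw [closure_compl] at key
  by_contra hmem
  apply hk
  refine ⟨?_, ?_, ?_, ?_⟩ <;> by_contra hq <;> exact key _ hq (by simp) (by simp) hmem

theorem openRect_horizontal_subset {S : Finset (ℤ × ℤ)} {q : ℤ × ℤ} (hq : q ∈ S)
    (hq' : (q.1 - 1, q.2) ∈ S) :
    openRect (q.1 - 1) q.2 (q.1 + 1) (q.2 + 1) ⊆ interior (meshRegion S) := by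
  refine interior_maximal ?_ (isOpen_openRect _ _ _ _)
  rintro ⟨x, y⟩ ⟨⟨hx1, hx2⟩, hy1, hy2⟩
  push_cast at hx1 hx2 hy1 hy2
  simp only [meshRegion, Set.mem_iUnion]
  rcases le_total (q.1 : ℝ) x with hx | hx
  · exact ⟨q, hq, ⟨hx, hx2.le⟩, hy1.le, hy2.le⟩
  · exact ⟨_, hq', ⟨by push_cast; exact hx1.le, by simpa using hx⟩, hy1.le, hy2.le⟩

theorem openRect_vertical_subset {S : Finset (ℤ × ℤ)} {q : ℤ × ℤ} (hq : q ∈ S)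
    (hq' : (q.1, q.2 - 1) ∈ S) :
    openRect q.1 (q.2 - 1) (q.1 + 1) (q.2 + 1) ⊆ interior (meshRegion S) := by
  refine interior_maximal ?_ (isOpen_openRect _ _ _ _)
  rintro ⟨x, y⟩ ⟨⟨hx1, hx2⟩, hy1, hy2⟩
  push_cast at hx1 hx2 hy1 hy2
  simp only [meshRegion, Set.mem_iUnion]
  rcases le_total (q.2 : ℝ) y with hy | hy
  · exact ⟨q, hq, ⟨hx1.le, hx2.le⟩, hy, hy2.le⟩
  · exact ⟨_, hq', ⟨hx1.le, hx2.le⟩, by push_cast; exact hy1.le, by simpa using hy⟩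

theorem log_neg_of_im_pos {w : ℂ} (h : 0 < w.im) :
    Complex.log (-w) = Complex.log w - Real.pi * Complex.I := by
  simp only [Complex.log, norm_neg, Complex.arg_neg_eq_arg_sub_pi_of_im_pos h]
  push_cast
  ring

theorem log_neg_of_im_neg {w : ℂ} (h : w.im < 0) :
    Complex.log (-w) = Complex.log w + Real.pi * Complex.I := by
  simp only [Complex.log, norm_neg, Complex.arg_neg_eq_arg_add_pi_of_im_neg h]
  push_cast
  ring

/-- If `Ω` is simply connected and `k` is not an interior vertex, then there is a function on
squares that is constant across interior edges, except for a fixed nonzero jump across the edges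
of the horizontal ray to the left of `k`. -/
theorem exists_jump_s13 {S : Finset (ℤ × ℤ)} (hS : SimplyConnectedSpace ↥(interior (meshRegion S)))
    {k : ℤ × ℤ} (hk : ¬ interiorVertex S k) :
    ∃ (n : ℤ × ℤ → ℂ) (t : ℂ), t ≠ 0 ∧
      (∀ q ∈ S, (q.1 - 1, q.2) ∈ S → n q - n (q.1 - 1, q.2) = 0) ∧
      (∀ q ∈ S, (q.1, q.2 - 1) ∈ S →
        n q - n (q.1, q.2 - 1) = if q.1 < k.1 ∧ q.2 = k.2 then t else 0) := by
  have hne : ∀ z ∈ interior (meshRegion S), displacement k z ≠ 0 := by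
    rintro ⟨x, y⟩ hz h0
    have hx := congrArg Complex.re h0
    have hy := congrArg Complex.im h0
    simp only [displacement, Complex.zero_re, Complex.zero_im] at hx hy
    rw [sub_eq_zero.1 hx, sub_eq_zero.1 hy] at hz
    exact coe_notMem_interior_meshRegion hk hz
  obtain ⟨L, hLc, hL⟩ := Complex.exists_continuousOn_eqOn_exp_comp
    (U := interior (meshRegion S)) hS isOpen_interior
    (continuous_displacement k).continuousOn (by rintro ⟨z, hz, h0⟩; exact hne z hz h0)
  have step : ∀ {R : Set (ℝ × ℝ)} {u : ℂ}, IsPreconnected R → R ⊆ interior (meshRegion S) →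
      u = 1 ∨ u = -1 → (∀ z ∈ R, u * displacement k z ∈ Complex.slitPlane) →
      ∀ {a b : ℝ × ℝ}, a ∈ R → b ∈ R →
        L a - Complex.log (u * displacement k a) = L b - Complex.log (u * displacement k b) := by
    intro R u hR hRS hu hslit a b ha hb
    have hlog : ContinuousOn (fun z => Complex.log (u * displacement k z)) R :=
      ContinuousOn.clog
        ((continuous_const.mul (continuous_displacement k)).continuousOn) hslit
    have hu0 : u ≠ 0 := by rcases hu with rfl | rfl <;> simp
    have := sub_eq_sub_of_exp_eqOn hR (L := L)
      (M := fun z => Complex.log (u * displacement k z) - Complex.log u) (hLc.mono hRS)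
      (by fun_prop)
      (fun x hx => by
        rw [Complex.exp_sub, Complex.exp_log (Complex.slitPlane_ne_zero (hslit x hx)),
          Complex.exp_log hu0]
        have := hL (hRS hx)
        simp only [Function.comp_apply] at this
        rw [this]
        field_simp) ha hb
    linear_combination this
  refine ⟨fun q => L (center q) - Complex.log (displacement k (center q)),
    -(2 * Real.pi * Complex.I), by simp [Real.pi_ne_zero], fun q hq hq' => ?_, fun q hq hq' => ?_⟩
  · have := step (u := 1) (isPreconnected_openRect _ _ _ _) (openRect_horizontal_subset hq hq')
      (Or.inl rfl) (fun z hz => ?_) (a := center q) (b := center (q.1 - 1, q.2)) ?_ ?_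
    · simp only [one_mul] at this
      exact sub_eq_zero.2 this
    · obtain ⟨-, hz1, hz2⟩ := hz
      rw [one_mul, Complex.mem_slitPlane_iff]
      right
      simp only [displacement]
      rcases lt_or_ge q.2 k.2 with h | h
      · have h' : ((q.2 + 1 : ℤ) : ℝ) ≤ k.2 := Int.cast_le.2 h
        exact (by linarith : z.2 - k.2 < 0).ne
      · have h' : (k.2 : ℝ) ≤ q.2 := Int.cast_le.2 h
        exact (by linarith : 0 < z.2 - k.2).ne'
    · simp only [center, openRect, Set.mem_prod, Set.mem_Ioo]; push_cast
      refine ⟨⟨?_, ?_⟩, ?_, ?_⟩ <;> linarith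
    · simp only [center, openRect, Set.mem_prod, Set.mem_Ioo]; push_cast
      refine ⟨⟨?_, ?_⟩, ?_, ?_⟩ <;> linarith
  · have ha : center q ∈ openRect q.1 (q.2 - 1) (q.1 + 1) (q.2 + 1) := by
      simp only [center, openRect, Set.mem_prod, Set.mem_Ioo]; push_cast
      refine ⟨⟨?_, ?_⟩, ?_, ?_⟩ <;> linarith
    have hb : center (q.1, q.2 - 1) ∈ openRect q.1 (q.2 - 1) (q.1 + 1) (q.2 + 1) := by
      simp only [center, openRect, Set.mem_prod, Set.mem_Ioo]; push_cast
      refine ⟨⟨?_, ?_⟩, ?_, ?_⟩ <;> linarith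
    have hstep := fun u hu hslit => step (u := u) (isPreconnected_openRect _ _ _ _)
      (openRect_vertical_subset hq hq') hu hslit ha hb
    split_ifs with hc
    · obtain ⟨h1, h2⟩ := hc
      have := hstep (-1) (Or.inr rfl) (fun z hz => ?_)
      · simp only [neg_mul, one_mul] at this
        rw [log_neg_of_im_pos, log_neg_of_im_neg] at this
        · linear_combination this
        · simp only [displacement, center, h2]; push_cast; linarith
        · simp only [displacement, center, h2]; linarith
      · obtain ⟨⟨-, hz2⟩, -⟩ := hz
        rw [Complex.mem_slitPlane_iff]
        left
        have h' : ((q.1 + 1 : ℤ) : ℝ) ≤ k.1 := Int.cast_le.2 h1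
        simp only [displacement, neg_mul, one_mul, Complex.neg_re]
        linarith
    · have := hstep 1 (Or.inl rfl) (fun z hz => ?_)
      · simp only [one_mul] at this
        exact sub_eq_zero.2 this
      · obtain ⟨⟨hz1, -⟩, hz3, hz4⟩ := hz
        rw [one_mul, Complex.mem_slitPlane_iff]
        simp only [displacement]
        rcases le_or_gt k.1 q.1 with h | h
        · left
          have h' : (k.1 : ℝ) ≤ q.1 := Int.cast_le.2 h
          linarith
        · right
          rcases lt_or_gt_of_ne (fun e => hc ⟨h, e⟩ : q.2 ≠ k.2) with h2 | h2
          · have h' : ((q.2 + 1 : ℤ) : ℝ) ≤ k.2 := Int.cast_le.2 h2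
            exact (by linarith : z.2 - k.2 < 0).ne
          · have h' : (k.2 : ℝ) ≤ (q.2 - 1 : ℤ) := Int.cast_le.2 (by omega)
            exact (by linarith : 0 < z.2 - k.2).ne'

theorem sum_sub_eq_sum {G M : Type*} [AddGroup G] [AddCommMonoid M] (K : Finset G) (d : G)
    (F : G → M) (hF : ∀ v, F v ≠ 0 → (v ∈ K ↔ v + d ∈ K)) :
    ∑ v ∈ K, F (v - d) = ∑ v ∈ K, F v := by
  refine Finset.sum_bij_ne_zero (fun v _ _ => v - d) (fun v hv h0 => ?_)
    (fun v _ _ w _ _ h => sub_left_injective h) (fun v hv h0 => ?_) (fun _ _ _ => rfl)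
  · rw [hF _ h0, sub_add_cancel]
    exact hv
  · exact ⟨v + d, (hF v h0).1 hv, by simpa using h0, by simp⟩

/-- If `Ω` is simply connected, then a finite set of non-interior lattice points that is a union
of components of the set of all non-interior lattice points is empty. -/
theorem eq_empty_of_adjacent_closed {S : Finset (ℤ × ℤ)}
    (hS : SimplyConnectedSpace ↥(interior (meshRegion S))) (K : Finset (ℤ × ℤ))
    (hK : ∀ v ∈ K, ¬ interiorVertex S v)
    (hx : ∀ v, ¬ interiorVertex S v → ¬ interiorVertex S (v + (1, 0)) →
      (v ∈ K ↔ v + (1, 0) ∈ K))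
    (hy : ∀ v, ¬ interiorVertex S v → ¬ interiorVertex S (v + (0, 1)) →
      (v ∈ K ↔ v + (0, 1) ∈ K)) : K = ∅ := by
  by_contra hne
  obtain ⟨k, hk⟩ := Finset.nonempty_iff_ne_empty.2 hne
  obtain ⟨n, t, ht, hn1, hn2⟩ := exists_jump_s13 hS (hK k hk)
  let H : ℤ × ℤ → ℂ := fun v =>
    n v - n (v.1, v.2 - 1) - if v.1 < k.1 ∧ v.2 = k.2 then t else 0
  let V : ℤ × ℤ → ℂ := fun v => n v - n (v.1 - 1, v.2)
  have hH : ∑ v ∈ K, H (v - (1, 0)) = ∑ v ∈ K, H v := by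
    refine sum_sub_eq_sum K (1, 0) H fun v hv => ?_
    have : ¬ (v ∈ S ∧ (v.1, v.2 - 1) ∈ S) := fun h => hv (sub_eq_zero.2 (hn2 v h.1 h.2))
    refine hx v (fun h => this ⟨h.2.2.2, h.2.2.1⟩) fun h => this ?_
    simp only [interiorVertex, Prod.fst_add, Prod.snd_add, add_sub_cancel_right, add_zero] at h
    exact ⟨h.2.1, h.1⟩
  have hV : ∑ v ∈ K, V (v - (0, 1)) = ∑ v ∈ K, V v := by
    refine sum_sub_eq_sum K (0, 1) V fun v hv => ?_
    have : ¬ (v ∈ S ∧ (v.1 - 1, v.2) ∈ S) := fun h => hv (hn1 v h.1 h.2)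
    refine hy v (fun h => this ⟨h.2.2.2, h.2.1⟩) fun h => this ?_
    simp only [interiorVertex, Prod.fst_add, Prod.snd_add, add_sub_cancel_right, add_zero] at h
    exact ⟨h.2.2.1, h.1⟩
  have hdiv : ∀ v : ℤ × ℤ,
      H v - H (v - (1, 0)) - (V v - V (v - (0, 1))) = if v = k then t else 0 := by
    rintro ⟨x, y⟩
    simp only [H, V, Prod.mk_sub_mk, sub_zero, Prod.ext_iff]
    split_ifs <;> first | (exfalso; omega) | ring
  clear_value H V
  have hsum := Finset.sum_congr (rfl : K = K) fun v _ => hdiv v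
  rw [Finset.sum_ite_eq' K k, if_pos hk, Finset.sum_sub_distrib, Finset.sum_sub_distrib,
    Finset.sum_sub_distrib, hH, hV] at hsum
  exact ht (by simpa using hsum.symm)

/-- The discrete rotated gradient, at vertices, of a stream function `ψ` on squares. -/
noncomputable def rotGrad (ψ : ℤ × ℤ → ℝ) (v : ℤ × ℤ) : ℝ × ℝ :=
  ((ψ (v.1 - 1, v.2) - ψ (v.1, v.2 - 1) + (ψ v - ψ (v.1 - 1, v.2 - 1))) / 2,
    (ψ (v.1 - 1, v.2) - ψ (v.1, v.2 - 1) - (ψ v - ψ (v.1 - 1, v.2 - 1))) / 2)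

theorem Ddiv_rotGrad (ψ : ℤ × ℤ → ℝ) (q : ℤ × ℤ) : Ddiv (rotGrad ψ) q = 0 := by
  simp only [Ddiv, dX, dY, rotGrad, add_sub_cancel_right]
  ring

theorem rotGrad_eq_zero_iff {ψ : ℤ × ℤ → ℝ} {v : ℤ × ℤ} :
    rotGrad ψ v = 0 ↔
      ψ (v.1 - 1, v.2) = ψ (v.1, v.2 - 1) ∧ ψ v = ψ (v.1 - 1, v.2 - 1) := by
  simp only [rotGrad, Prod.ext_iff, Prod.fst_zero, Prod.snd_zero]
  constructor
  · rintro ⟨h1, h2⟩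
    constructor <;> linarith
  · rintro ⟨h1, h2⟩
    constructor <;> linarith

/-- A finitely supported stream function with vanishing rotated gradient is zero. -/
theorem eq_zero_of_rotGrad_eq_zero {ψ : ℤ × ℤ → ℝ} (hfin : ψ.support.Finite)
    (h : ∀ v, rotGrad ψ v = 0) : ψ = 0 := by
  have step : ∀ (q : ℤ × ℤ) (n : ℕ), ψ (q.1 - n, q.2 - n) = ψ q := by
    intro q n
    induction n with
    | zero => simp
    | succ n ih =>
      rw [← ih, (rotGrad_eq_zero_iff.1 (h (q.1 - n, q.2 - n))).2]
      push_cast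
      simp only [sub_sub]
  ext q
  by_contra hq
  refine Set.infinite_of_injective_forall_mem (f := fun n : ℕ => (q.1 - (n : ℤ), q.2 - (n : ℤ)))
    (fun a b hab => ?_) (fun n => ?_) hfin
  · have := congrArg Prod.fst hab
    simp only at this
    omega
  · rw [Function.mem_support, step q n]
    exact hq

/-- A finitely supported, discretely divergence-free function on the lattice is the rotated
gradient of a finitely supported stream function. -/
theorem exists_rotGrad_eq {c : ℤ × ℤ → ℝ × ℝ} (hfin : c.support.Finite)
    (hD : ∀ q, Ddiv c q = 0) : ∃ ψ : ℤ × ℤ → ℝ, ψ.support.Finite ∧ rotGrad ψ = c := by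
  obtain ⟨N, hN⟩ : ∃ N : ℤ, ∀ i j : ℤ, i < -N ∨ N < i ∨ j < -N ∨ N < j → c (i, j) = 0 := by
    obtain ⟨B, hB⟩ := (hfin.image fun v : ℤ × ℤ => max |v.1| |v.2|).bddAbove
    refine ⟨B, fun i j hij => ?_⟩
    by_contra h0
    have := hB ⟨(i, j), h0, rfl⟩
    simp only [sup_le_iff, abs_le] at this
    omega
  let m : ℤ → ℤ → ℝ := fun i j => (c (i, j)).1 - (c (i, j)).2
  let p : ℤ → ℤ → ℝ := fun i j => (c (i, j)).1 + (c (i, j)).2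
  have hm : ∀ i j, i < -N ∨ N < i ∨ j < -N ∨ N < j → m i j = 0 := fun i j h => by
    simp [m, hN i j h]
  have hp : ∀ i j, i < -N ∨ N < i ∨ j < -N ∨ N < j → p i j = 0 := fun i j h => by
    simp [p, hN i j h]
  let φ : ℤ → ℤ → ℝ := fun i j => ∑ s ∈ Finset.range (i + N + 1).toNat, m (i - s) (j - s)
  have φ_left : ∀ i j, i < -N → φ i j = 0 := fun i j h => by
    simp [φ, show (i + N + 1).toNat = 0 by omega]
  have φ_below : ∀ i j, j < -N → φ i j = 0 := fun i j h =>
    Finset.sum_eq_zero fun s _ => hm _ _ (by omega)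
  have φ_diag : ∀ i j, φ i j - φ (i - 1) (j - 1) = m i j := by
    intro i j
    rcases lt_or_ge i (-N) with h | h
    · rw [φ_left i j h, φ_left (i - 1) _ (by omega), hm i j (Or.inl h), sub_zero]
    · simp only [φ]
      rw [show (i + N + 1).toNat = (i - 1 + N + 1).toNat + 1 by omega, Finset.sum_range_succ']
      simp [sub_sub, add_comm]
  have hdiv : ∀ i j, p (i + 1) (j + 1) - p i j + m (i + 1) j - m i (j + 1) = 0 := by
    intro i j
    have := hD (i, j)
    simp only [Ddiv, dX, dY] at this
    simp only [p, m]
    linarith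
  have φ_anti : ∀ i j, φ (i - 1) j - φ i (j - 1) = p i j := by
    have key : ∀ (n : ℕ) (i j : ℤ), i < -N + n → φ (i - 1) j - φ i (j - 1) = p i j := by
      intro n
      induction n with
      | zero =>
        intro i j h
        rw [φ_left i _ (by simpa using h), φ_left (i - 1) _ (by push_cast at h; omega),
          hp i j (by push_cast at h; omega), sub_zero]
      | succ n ih =>
        intro i j h
        have h1 := ih (i - 1) (j - 1) (by push_cast at h; omega)
        have h2 := hdiv (i - 1) (j - 1)
        have h3 := φ_diag (i - 1) j
        have h4 := φ_diag i (j - 1)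
        simp only [sub_add_cancel] at h2
        linarith
    exact fun i j => key (i + N + 1).toNat i j (by omega)
  have φ_right : ∀ i j, N ≤ i → φ i j = 0 := by
    have key : ∀ (n : ℕ) (i j : ℤ), N ≤ i → j < -N + n → φ i j = 0 := by
      intro n
      induction n with
      | zero => exact fun i j _ h => φ_below i j (by simpa using h)
      | succ n ih =>
        intro i j hi h
        have h1 := φ_anti (i + 1) j
        rw [hp _ _ (by omega), ih (i + 1) (j - 1) (by omega) (by push_cast at h; omega),
          add_sub_cancel_right, sub_zero] at h1
        exact h1
    exact fun i j h => key (j + N + 1).toNat i j h (by omega)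
  have φ_above : ∀ i j, N ≤ j → φ i j = 0 := by
    have key : ∀ (n : ℕ) (i j : ℤ), N ≤ j → i < -N + n → φ i j = 0 := by
      intro n
      induction n with
      | zero => exact fun i j _ h => φ_left i j (by simpa using h)
      | succ n ih =>
        intro i j hj h
        have h1 := φ_anti i (j + 1)
        rw [hp _ _ (by omega), ih (i - 1) (j + 1) (by omega) (by push_cast at h; omega),
          add_sub_cancel_right, zero_sub, neg_eq_zero] at h1
        exact h1
    exact fun i j h => key (i + N + 1).toNat i j h (by omega)
  refine ⟨fun q => φ q.1 q.2,
    (Set.finite_Icc ((-N, -N) : ℤ × ℤ) (N, N)).subset fun q hq => ?_, ?_⟩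
  · by_contra hmem
    refine hq ?_
    simp only [Set.mem_Icc, Prod.le_def, not_and_or, not_le] at hmem
    rcases hmem with (h | h) | (h | h)
    · exact φ_left _ _ h
    · exact φ_below _ _ h
    · exact φ_right _ _ h.le
    · exact φ_above _ _ h.le
  · ext v <;> simp only [rotGrad, φ_diag, φ_anti, p, m] <;> ring

/-- A finitely supported stream function whose rotated gradient vanishes at all non-interior
vertices is supported on the interior squares, provided `Ω` is simply connected. -/
theorem eq_zero_of_not_interiorSquare {S : Finset (ℤ × ℤ)}
    (hS : SimplyConnectedSpace ↥(interior (meshRegion S))) {ψ : ℤ × ℤ → ℝ}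
    (hfin : ψ.support.Finite) (hψ : ∀ v, ¬ interiorVertex S v → rotGrad ψ v = 0)
    {q : ℤ × ℤ} (hq : ¬ interiorSquare S q) : ψ q = 0 := by
  let A : Set (ℤ × ℤ) := {v | ¬ interiorVertex S v ∧ (ψ v ≠ 0 ∨ ψ (v.1 - 1, v.2) ≠ 0)}
  have hA : A.Finite := by
    refine (hfin.union (hfin.image fun v => v + (1, 0))).subset ?_
    rintro v ⟨-, h | h⟩
    · exact Or.inl h
    · exact Or.inr ⟨_, h, by ext <;> simp⟩
  have hempty : hA.toFinset = ∅ := by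
    refine eq_empty_of_adjacent_closed hS _ (fun v hv => ((hA.mem_toFinset).1 hv).1)
      (fun v h1 h2 => ?_) (fun v h1 h2 => ?_)
    · have e1 := rotGrad_eq_zero_iff.1 (hψ _ h1)
      have e2 := rotGrad_eq_zero_iff.1 (hψ _ h2)
      simp only [Prod.fst_add, Prod.snd_add, add_sub_cancel_right, add_zero, Prod.mk.eta] at e2
      simp only [Set.Finite.mem_toFinset, A, Set.mem_ofPred_eq, h1, h2, not_false_eq_true,
        true_and, Prod.fst_add, Prod.snd_add, add_sub_cancel_right, add_zero, Prod.mk.eta]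
      rw [e2.2, e1.1, or_comm]
    · have e1 := rotGrad_eq_zero_iff.1 (hψ _ h1)
      have e2 := rotGrad_eq_zero_iff.1 (hψ _ h2)
      simp only [Prod.fst_add, Prod.snd_add, add_sub_cancel_right, add_zero, Prod.mk.eta] at e2
      simp only [Set.Finite.mem_toFinset, A, Set.mem_ofPred_eq, h1, h2, not_false_eq_true,
        true_and, Prod.fst_add, Prod.snd_add, add_zero]
      rw [e2.2, e2.1, or_comm]
  have hzero : ∀ v, ¬ interiorVertex S v → ψ v = 0 ∧ ψ (v.1 - 1, v.2) = 0 ∧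
      ψ (v.1, v.2 - 1) = 0 ∧ ψ (v.1 - 1, v.2 - 1) = 0 := by
    intro v hv
    have hnot : v ∉ A := fun h => by
      have := (hA.mem_toFinset).2 h
      simp [hempty] at this
    simp only [A, Set.mem_ofPred_eq, hv, not_false_eq_true, true_and, not_or, not_not] at hnot
    have e := rotGrad_eq_zero_iff.1 (hψ _ hv)
    exact ⟨hnot.1, hnot.2, e.1 ▸ hnot.2, e.2 ▸ hnot.1⟩
  simp only [interiorSquare, not_and_or (a := interiorVertex S _)] at hq
  rcases hq with h | h | h | h
  · exact (hzero _ h).1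
  · simpa using (hzero _ h).2.1
  · simpa using (hzero _ h).2.2.1
  · simpa using (hzero _ h).2.2.2

/-- Extension by zero of a function on the interior squares of `S`. -/
noncomputable def extendInterior (S : Finset (ℤ × ℤ)) :
    (↥(S.filter fun q => interiorSquare S q) → ℝ) →ₗ[ℝ] (ℤ × ℤ → ℝ) :=
  Function.ExtendByZero.linearMap ℝ Subtype.val

theorem extendInterior_coe {S : Finset (ℤ × ℤ)} (g : ↥(S.filter fun q => interiorSquare S q) → ℝ)
    (q : ↥(S.filter fun q => interiorSquare S q)) : extendInterior S g q = g q :=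
  Subtype.val_injective.extend_apply g (0 : ℤ × ℤ → ℝ) q

theorem extendInterior_of_not {S : Finset (ℤ × ℤ)}
    (g : ↥(S.filter fun q => interiorSquare S q) → ℝ) {q : ℤ × ℤ} (hq : ¬ interiorSquare S q) :
    extendInterior S g q = 0 := by
  refine Function.extend_apply' g (0 : ℤ × ℤ → ℝ) q ?_
  rintro ⟨a, rfl⟩
  exact hq (Finset.mem_filter.1 a.2).2

theorem finite_support_extendInterior {S : Finset (ℤ × ℤ)}
    (g : ↥(S.filter fun q => interiorSquare S q) → ℝ) : (extendInterior S g).support.Finite := by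
  refine S.finite_toSet.subset fun q hq => ?_
  by_contra hqS
  exact hq (extendInterior_of_not g fun h => hqS h.1.2.2.2)

/-- The rotated gradient, from functions on the interior squares to divergence-free functions on
the interior vertices. -/
noncomputable def rotGradKerD (S : Finset (ℤ × ℤ)) :
    (↥(S.filter fun q => interiorSquare S q) → ℝ) →ₗ[ℝ] kerD S where
  toFun g := ⟨rotGrad (extendInterior S g), fun v hv => by
    rw [rotGrad_eq_zero_iff]
    rw [extendInterior_of_not g (q := v) fun h => hv h.1,
      extendInterior_of_not g (q := (v.1 - 1, v.2)) fun h => hv (by simpa using h.2.1),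
      extendInterior_of_not g (q := (v.1, v.2 - 1)) fun h => hv (by simpa using h.2.2.1),
      extendInterior_of_not g (q := (v.1 - 1, v.2 - 1)) fun h => hv (by simpa using h.2.2.2)]
    exact ⟨rfl, rfl⟩, fun q _ => Ddiv_rotGrad _ q⟩
  map_add' f g := by
    ext v <;> simp [rotGrad] <;> ring
  map_smul' r g := by
    ext v <;> simp [rotGrad] <;> ring

theorem rotGradKerD_injective (S : Finset (ℤ × ℤ)) : Function.Injective (rotGradKerD S) := by
  refine (injective_iff_map_eq_zero _).2 fun g hg => ?_
  have := eq_zero_of_rotGrad_eq_zero (finite_support_extendInterior g)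
    (fun v => congrFun (congrArg Subtype.val hg) v)
  ext q
  rw [← extendInterior_coe g q, this]
  rfl

theorem rotGradKerD_surjective {S : Finset (ℤ × ℤ)}
    (hS : SimplyConnectedSpace ↥(interior (meshRegion S))) :
    Function.Surjective (rotGradKerD S) := by
  rintro ⟨c, hc, hD⟩
  have hfin : c.support.Finite := by
    refine S.finite_toSet.subset fun v hv => ?_
    by_contra hvS
    exact hv (hc v fun h => hvS h.2.2.2)
  have hD' : ∀ q, Ddiv c q = 0 := by
    intro q
    by_cases hq : q ∈ S
    · exact hD q hq
    · simp [Ddiv, dX, dY, hc q (fun h => hq h.2.2.2),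
        hc (q.1 + 1, q.2) (fun h => hq (by simpa using h.2.1)),
        hc (q.1, q.2 + 1) (fun h => hq (by simpa using h.2.2.1)),
        hc (q.1 + 1, q.2 + 1) (fun h => hq (by simpa using h.1))]
  obtain ⟨ψ, hψ, rfl⟩ := exists_rotGrad_eq hfin hD'
  refine ⟨fun q => ψ q, Subtype.ext ?_⟩
  have : extendInterior S (fun q => ψ q) = ψ := by
    ext q
    by_cases hq : interiorSquare S q
    · exact extendInterior_coe _ ⟨q, Finset.mem_filter.2 ⟨hq.1.2.2.2, hq⟩⟩
    · rw [extendInterior_of_not _ hq, eq_zero_of_not_interiorSquare hS hψ hc hq]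
  exact congrArg rotGrad this

/-- Under the standing assumptions, the kernel of the linear map `c ↦ Dc` on
the space of functions `c : ℤ × ℤ → ℝ × ℝ` supported on the interior vertices has dimension
(as a real vector space) equal to the number of interior squares of `S`. -/
theorem finrank_kerD (S : Finset (ℤ × ℤ)) (h : Standing S) :
    Module.finrank ℝ ↥(kerD S) = (S.filter fun q => interiorSquare S q).card := by
  rw [← (LinearEquiv.ofBijective (rotGradKerD S)
    ⟨rotGradKerD_injective S, rotGradKerD_surjective h.simplyConnected⟩).finrank_eq,
    Module.finrank_fintype_fun_eq_card, Fintype.card_coe]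
end
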